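/- Let ω > 0 and 1 < α < 3/2 be constants, N a sufficiently large integer, and n an integer with 1 ≤ n ≤ N. Let \mathcal{P} be the set of primes p ≤ N such that p - 1 has a divisor d with \sqrt{N} L^{-ω} < d < \sqrt{N} L^{ω}. Then the number of ordered pairs of primes (p_1, p_2) with p_1 + p_2 = n, Ω(p_1 - 1) ≤ α log L and p_1 ∈ \mathcal{P} is \ll N L^{γ(α/2) - 3} (\log L)^3, where L = log N, γ(c) = c - c log c, Ω(k) is the number of prime factors of k counted with multiplicity, and the implied constant depends only on ω and α. -/

import Mathlib

open Finset
open scoped Classical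

noncomputable section

/-- p belongs to the set 𝒫 = 𝒫_ω(N): p - 1 has a divisor d with
√N (log N)^{-ω} < d < √N (log N)^{ω}. -/
def inP (N : ℕ) (ω : ℝ) (p : ℕ) : Prop :=
  ∃ d : ℕ, d ∣ p - 1 ∧ Real.sqrt N * Real.log N ^ (-ω) < (d : ℝ) ∧
    (d : ℝ) < Real.sqrt N * Real.log N ^ ω

/-- γ(c) = c - c log c. -/
def gam (c : ℝ) : ℝ := c - c * Real.log c

/-- Ω(k): the number of prime factors of k counted with multiplicity. -/
def bigOmega (k : ℕ) : ℕ := k.primeFactorsList.length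

theorem sum_neg_one_pow_card_Icc {ι : Type*} [DecidableEq ι] {l m : Finset ι} (hlm : l ⊆ m) :
    ∑ d ∈ m.powerset with l ⊆ d, (-1 : ℝ) ^ #d = if l = m then (-1) ^ #l else 0 := by
  have h1 : ∑ d ∈ m.powerset with l ⊆ d, (-1 : ℝ) ^ #d
      = ∑ e ∈ (m \ l).powerset, (-1) ^ #l * (-1 : ℝ) ^ #e := by
    symm
    refine Finset.sum_bij' (fun e _ => l ∪ e) (fun d _ => d \ l) ?_ ?_ ?_ ?_ ?_
    · intro e he
      simp only [mem_powerset, mem_filter] at he ⊢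
      exact ⟨union_subset hlm (he.trans sdiff_subset), subset_union_left⟩
    · intro d hd
      simp only [mem_powerset, mem_filter] at hd ⊢
      exact sdiff_subset_sdiff hd.1 le_rfl
    · intro e he
      simp only [mem_powerset] at he
      rw [union_sdiff_cancel_left]
      exact (disjoint_of_subset_right he disjoint_sdiff)
    · intro d hd
      simp only [mem_powerset, mem_filter] at hd
      exact union_sdiff_of_subset hd.2
    · intro e he
      simp only [mem_powerset] at he
      rw [card_union_of_disjoint (disjoint_of_subset_right he disjoint_sdiff), pow_add]
  rw [h1, ← mul_sum]
  have h2 : ∑ e ∈ (m \ l).powerset, (-1 : ℝ) ^ #e = if m \ l = ∅ then 1 else 0 := by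
    exact_mod_cast congrArg (Int.cast : ℤ → ℝ) (sum_powerset_neg_one_pow_card (x := m \ l))
  rw [h2]
  by_cases h : l = m
  · simp [h]
  · have : ¬ m \ l = ∅ := by
      rw [sdiff_eq_empty_iff_subset]
      exact fun h' => h (subset_antisymm hlm h')
    simp [h, this]

/-- The optimal weights of the Selberg sieve, indexed by finite sets of primes. -/
def selbergWeight {ι : Type*} [DecidableEq ι] (D : Finset (Finset ι)) (g : ι → ℝ) (t : Finset ι) : ℝ :=
  (-1) ^ #t * (∏ i ∈ t, g i)⁻¹ * (∑ m ∈ D with t ⊆ m, ∏ i ∈ m, g i / (1 - g i)) /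
    ∑ m ∈ D, ∏ i ∈ m, g i / (1 - g i)

section Selberg

variable {ι : Type*} {D : Finset (Finset ι)} {g : ι → ℝ}

theorem selberg_sum_pos (hg : ∀ t ∈ D, ∀ i ∈ t, 0 < g i ∧ g i < 1) (h0 : ∅ ∈ D) :
    0 < ∑ m ∈ D, ∏ i ∈ m, g i / (1 - g i) := by
  refine sum_pos (fun m hm => prod_pos fun i hi => ?_) ⟨_, h0⟩
  obtain ⟨h1, h2⟩ := hg m hm i hi
  exact div_pos h1 (by linarith)

variable [DecidableEq ι]

theorem selbergWeight_empty (hg : ∀ t ∈ D, ∀ i ∈ t, 0 < g i ∧ g i < 1) (h0 : ∅ ∈ D) :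
    selbergWeight D g ∅ = 1 := by
  have := selberg_sum_pos hg h0
  rw [selbergWeight, card_empty, pow_zero, prod_empty, inv_one, one_mul, one_mul,
    filter_true_of_mem fun m _ => empty_subset m, div_self this.ne']

theorem abs_selbergWeight_le (hg : ∀ t ∈ D, ∀ i ∈ t, 0 < g i ∧ g i < 1) (h0 : ∅ ∈ D)
    {t : Finset ι} (ht : t ∈ D) : |selbergWeight D g t| ≤ (∏ i ∈ t, g i)⁻¹ := by
  have hS := selberg_sum_pos hg h0
  have hp : 0 < ∏ i ∈ t, g i := prod_pos fun i hi => (hg t ht i hi).1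
  have hnn : ∀ m ∈ D, 0 ≤ ∏ i ∈ m, g i / (1 - g i) := fun m hm => prod_nonneg fun i hi => by
    obtain ⟨h1, h2⟩ := hg m hm i hi
    exact (div_pos h1 (by linarith)).le
  have hle : ∑ m ∈ D with t ⊆ m, ∏ i ∈ m, g i / (1 - g i) ≤
      ∑ m ∈ D, ∏ i ∈ m, g i / (1 - g i) :=
    sum_le_sum_of_subset_of_nonneg (filter_subset _ _) fun m hm _ => hnn m hm
  have hge : 0 ≤ ∑ m ∈ D with t ⊆ m, ∏ i ∈ m, g i / (1 - g i) :=
    sum_nonneg fun m hm => hnn m (mem_filter.1 hm).1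
  rw [selbergWeight, abs_div, abs_mul, abs_mul, abs_pow, abs_neg, abs_one, one_pow, one_mul,
    abs_of_pos hS, abs_of_nonneg hge, abs_of_pos (inv_pos.2 hp), div_le_iff₀ hS]
  exact mul_le_mul_of_nonneg_left hle (inv_pos.2 hp).le

theorem sum_prod_mul_selbergWeight (hg : ∀ t ∈ D, ∀ i ∈ t, 0 < g i ∧ g i < 1)
    (hdown : ∀ t ∈ D, ∀ s ⊆ t, s ∈ D) {l : Finset ι} (hl : l ∈ D) :
    ∑ t ∈ D with l ⊆ t, (∏ i ∈ t, g i) * selbergWeight D g t =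
      (-1) ^ #l * (∏ i ∈ l, g i / (1 - g i)) / ∑ m ∈ D, ∏ i ∈ m, g i / (1 - g i) := by
  have h1 : ∀ t ∈ D.filter (l ⊆ ·), (∏ i ∈ t, g i) * selbergWeight D g t =
      (∑ m ∈ D, if t ⊆ m then (-1) ^ #t * ∏ i ∈ m, g i / (1 - g i) else 0) /
        ∑ m ∈ D, ∏ i ∈ m, g i / (1 - g i) := by
    intro t ht
    have hp : 0 < ∏ i ∈ t, g i := prod_pos fun i hi => (hg t (mem_filter.1 ht).1 i hi).1
    rw [selbergWeight, ← sum_filter, ← mul_sum]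
    field_simp
  rw [sum_congr rfl h1, ← sum_div, sum_comm]
  congr 1
  have h2 : ∀ m ∈ D, (∑ t ∈ D with l ⊆ t,
      if t ⊆ m then (-1 : ℝ) ^ #t * ∏ i ∈ m, g i / (1 - g i) else 0) =
      if l = m then (-1) ^ #l * ∏ i ∈ l, g i / (1 - g i) else 0 := by
    intro m hm
    rw [← sum_filter, ← sum_mul]
    by_cases hlm : l ⊆ m
    · have : (D.filter (l ⊆ ·)).filter (· ⊆ m) = m.powerset.filter (l ⊆ ·) := by
        ext t
        simp only [mem_filter, mem_powerset]
        constructor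
        · rintro ⟨⟨_, h⟩, h'⟩
          exact ⟨h', h⟩
        · rintro ⟨h, h'⟩
          exact ⟨⟨hdown m hm t h, h'⟩, h⟩
      rw [this, sum_neg_one_pow_card_Icc hlm]
      split_ifs with h
      · rw [h]
      · simp
    · have : (D.filter (l ⊆ ·)).filter (· ⊆ m) = ∅ := by
        ext t
        simp only [mem_filter, notMem_empty, iff_false]
        rintro ⟨⟨_, h⟩, h'⟩
        exact hlm (h.trans h')
      have hne : l ≠ m := fun h => hlm h.subset
      simp [this, hne]
  rw [sum_congr rfl h2, sum_ite_eq, if_pos hl]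

theorem prod_union_eq (hg : ∀ t ∈ D, ∀ i ∈ t, 0 < g i ∧ g i < 1)
    {s t : Finset ι} (hs : s ∈ D) :
    ∏ i ∈ s ∪ t, g i = (∏ i ∈ s, g i) * (∏ i ∈ t, g i) *
      ∑ l ∈ (s ∩ t).powerset, (∏ i ∈ l, g i / (1 - g i))⁻¹ := by
  have h1 : ∑ l ∈ (s ∩ t).powerset, (∏ i ∈ l, g i / (1 - g i))⁻¹ =
      ∏ i ∈ s ∩ t, (g i)⁻¹ := by
    simp_rw [← prod_inv_distrib]
    rw [← prod_one_add]
    refine prod_congr rfl fun i hi => ?_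
    obtain ⟨h1, h2⟩ := hg s hs i (mem_inter.1 hi).1
    rw [inv_div, sub_div, div_self h1.ne']
    ring
  have h2 : (∏ i ∈ s ∩ t, g i) * ∏ i ∈ s ∩ t, (g i)⁻¹ = 1 := by
    rw [← prod_mul_distrib]
    exact prod_eq_one fun i hi => mul_inv_cancel₀ (hg s hs i (mem_inter.1 hi).1).1.ne'
  rw [h1, ← prod_union_inter, mul_assoc, h2, mul_one]

theorem selberg_quadratic_form (hg : ∀ t ∈ D, ∀ i ∈ t, 0 < g i ∧ g i < 1) (h0 : ∅ ∈ D)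
    (hdown : ∀ t ∈ D, ∀ s ⊆ t, s ∈ D) :
    ∑ s ∈ D, ∑ t ∈ D, selbergWeight D g s * selbergWeight D g t * ∏ i ∈ s ∪ t, g i =
      (∑ m ∈ D, ∏ i ∈ m, g i / (1 - g i))⁻¹ := by
  have hS := selberg_sum_pos hg h0
  set S := ∑ m ∈ D, ∏ i ∈ m, g i / (1 - g i) with hSdef
  have h1 : ∀ s ∈ D, ∀ t ∈ D,
      selbergWeight D g s * selbergWeight D g t * ∏ i ∈ s ∪ t, g i =
      ∑ l ∈ D, (∏ i ∈ l, g i / (1 - g i))⁻¹ *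
        ((if l ⊆ s then (∏ i ∈ s, g i) * selbergWeight D g s else 0) *
        (if l ⊆ t then (∏ i ∈ t, g i) * selbergWeight D g t else 0)) := by
    intro s hs t ht
    have : (s ∩ t).powerset = D.filter fun l => l ⊆ s ∧ l ⊆ t := by
      ext l
      simp only [mem_powerset, mem_filter, subset_inter_iff]
      exact ⟨fun h => ⟨hdown s hs l h.1, h⟩, fun h => h.2⟩
    rw [prod_union_eq hg hs, this, sum_filter, mul_sum, mul_sum]
    refine sum_congr rfl fun l _ => ?_
    by_cases h : l ⊆ s <;> by_cases h' : l ⊆ t <;> simp [h, h']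
    ring
  rw [sum_congr rfl fun s hs => sum_congr rfl fun t ht => h1 s hs t ht]
  simp_rw [sum_comm (s := D) (t := D) (f := fun t l => (∏ i ∈ l, g i / (1 - g i))⁻¹ * _)]
  rw [sum_comm]
  have h2 : ∀ l ∈ D, ∑ s ∈ D, ∑ t ∈ D, (∏ i ∈ l, g i / (1 - g i))⁻¹ *
        ((if l ⊆ s then (∏ i ∈ s, g i) * selbergWeight D g s else 0) *
        (if l ⊆ t then (∏ i ∈ t, g i) * selbergWeight D g t else 0)) =
        (∏ i ∈ l, g i / (1 - g i)) / S ^ 2 := by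
    intro l hl
    have hpos : 0 < ∏ i ∈ l, g i / (1 - g i) := prod_pos fun i hi => by
      obtain ⟨h1, h2⟩ := hg l hl i hi
      exact div_pos h1 (by linarith)
    simp_rw [← mul_sum]
    rw [← sum_mul, ← sum_filter, sum_prod_mul_selbergWeight hg hdown hl, ← hSdef]
    have : ((-1 : ℝ) ^ #l) ^ 2 = 1 := by rw [← pow_mul, mul_comm, pow_mul]; simp
    field_simp
    rw [this]
  rw [sum_congr rfl h2, ← sum_div, ← hSdef]
  field_simp

/-- The Selberg upper bound sieve with a crude error term. -/
theorem selberg_sieve (hg : ∀ t ∈ D, ∀ i ∈ t, 0 < g i ∧ g i < 1) (h0 : ∅ ∈ D)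
    (hdown : ∀ t ∈ D, ∀ s ⊆ t, s ∈ D) {β : Type*} (A : Finset β) (bad : ι → β → Prop)
    (X R W : ℝ) (hW : ∀ t ∈ D, (∏ i ∈ t, g i)⁻¹ ≤ W)
    (hR : ∀ s ∈ D, ∀ t ∈ D,
      |(#{b ∈ A | ∀ i ∈ s ∪ t, bad i b} : ℝ) - X * ∏ i ∈ s ∪ t, g i| ≤ R) :
    (#{b ∈ A | ∀ t ∈ D, ∀ i ∈ t, ¬ bad i b} : ℝ) ≤
      X / (∑ m ∈ D, ∏ i ∈ m, g i / (1 - g i)) + (#D * W) ^ 2 * R := by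
  set lam := selbergWeight D g with hlam
  have hW0 : 0 ≤ W := zero_le_one.trans (by simpa using hW ∅ h0)
  have hR0 : 0 ≤ R := (abs_nonneg _).trans (hR ∅ h0 ∅ h0)
  have hlamW : ∀ t ∈ D, |lam t| ≤ W := fun t ht => (abs_selbergWeight_le hg h0 ht).trans (hW t ht)
  have h1 : (#{b ∈ A | ∀ t ∈ D, ∀ i ∈ t, ¬ bad i b} : ℝ) ≤
      ∑ b ∈ A, (∑ t ∈ D, if ∀ i ∈ t, bad i b then lam t else 0) ^ 2 := by
    rw [card_filter, Nat.cast_sum]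
    refine sum_le_sum fun b _ => ?_
    split_ifs with h
    · have : (∑ t ∈ D, if ∀ i ∈ t, bad i b then lam t else 0) = 1 := by
        rw [sum_eq_single_of_mem ∅ h0]
        · simpa using selbergWeight_empty hg h0
        · intro t ht hne
          obtain ⟨i, hi⟩ := nonempty_iff_ne_empty.2 hne
          rw [if_neg]
          exact fun h' => h t ht i hi (h' i hi)
      rw [this]; simp
    · simpa using sq_nonneg _
  have h2 : ∑ b ∈ A, (∑ t ∈ D, if ∀ i ∈ t, bad i b then lam t else 0) ^ 2 =
      ∑ s ∈ D, ∑ t ∈ D, lam s * lam t * #{b ∈ A | ∀ i ∈ s ∪ t, bad i b} := by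
    simp_rw [sq, sum_mul_sum]
    rw [sum_comm]
    refine sum_congr rfl fun s _ => ?_
    rw [sum_comm]
    refine sum_congr rfl fun t _ => ?_
    rw [card_filter, Nat.cast_sum, mul_sum]
    refine sum_congr rfl fun b _ => ?_
    have : (∀ i ∈ s ∪ t, bad i b) ↔ (∀ i ∈ s, bad i b) ∧ ∀ i ∈ t, bad i b := by
      simp only [mem_union]
      exact ⟨fun h => ⟨fun i hi => h i (Or.inl hi), fun i hi => h i (Or.inr hi)⟩,
        fun h i hi => hi.elim (h.1 i) (h.2 i)⟩
    split_ifs <;> first | (exfalso; tauto) | simp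
  have h3 : ∑ s ∈ D, ∑ t ∈ D, lam s * lam t * #{b ∈ A | ∀ i ∈ s ∪ t, bad i b} ≤
      ∑ s ∈ D, ∑ t ∈ D, (X * (lam s * lam t * ∏ i ∈ s ∪ t, g i) + W * W * R) := by
    refine sum_le_sum fun s hs => sum_le_sum fun t ht => ?_
    have e1 : |lam s * lam t * ((#{b ∈ A | ∀ i ∈ s ∪ t, bad i b} : ℝ) - X * ∏ i ∈ s ∪ t, g i)| ≤
        W * W * R := by
      rw [abs_mul, abs_mul]
      exact mul_le_mul (mul_le_mul (hlamW s hs) (hlamW t ht) (abs_nonneg _) hW0) (hR s hs t ht)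
        (abs_nonneg _) (by positivity)
    have := (le_abs_self _).trans e1
    linarith
  refine h1.trans (h2.le.trans (h3.trans (le_of_eq ?_)))
  simp_rw [sum_add_distrib, ← mul_sum]
  rw [selberg_quadratic_form hg h0 hdown]
  simp only [sum_const, nsmul_eq_mul]
  ring

end Selberg

theorem card_filter_range_mul_of_coprime {m n : ℕ} (hmn : m.Coprime n) (hm : m ≠ 0) (hn : n ≠ 0)
    {p q : ℕ → Prop} [DecidablePred p] [DecidablePred q] (hp : Function.Periodic p m) (hq : Function.Periodic q n) :
    #{x ∈ range (m * n) | p x ∧ q x} = #{x ∈ range m | p x} * #{x ∈ range n | q x} := by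
  rw [← card_product]
  refine card_nbij' (fun x => (x % m, x % n))
    (fun y => (Nat.chineseRemainder hmn y.1 y.2 : ℕ)) ?_ ?_ ?_ ?_
  · intro x hx
    simp only [coe_filter, mem_range, Set.mem_ofPred_eq, coe_product, Set.mem_prod] at hx ⊢
    exact ⟨⟨Nat.mod_lt _ (Nat.pos_of_ne_zero hm), by rw [hp.map_mod_nat]; exact hx.2.1⟩,
      ⟨Nat.mod_lt _ (Nat.pos_of_ne_zero hn), by rw [hq.map_mod_nat]; exact hx.2.2⟩⟩
  · intro y hy
    simp only [coe_filter, mem_range, Set.mem_ofPred_eq, coe_product, Set.mem_prod] at hy ⊢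
    obtain ⟨h1, h2⟩ := (Nat.chineseRemainder hmn y.1 y.2).2
    refine ⟨Nat.chineseRemainder_lt_mul hmn _ _ hm hn, ?_, ?_⟩
    · rw [← hp.map_mod_nat, h1, hp.map_mod_nat]; exact hy.1.2
    · rw [← hq.map_mod_nat, h2, hq.map_mod_nat]; exact hy.2.2
  · intro x hx
    simp only [coe_filter, mem_range, Set.mem_ofPred_eq] at hx
    have h := Nat.chineseRemainder_modEq_unique hmn (a := x % m) (b := x % n) (z := x)
      (Nat.mod_modEq _ _).symm (Nat.mod_modEq _ _).symm
    have h' := Nat.ModEq.eq_of_lt_of_lt h hx.1 (Nat.chineseRemainder_lt_mul hmn _ _ hm hn)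
    exact h'.symm
  · intro y hy
    simp only [coe_filter, mem_range, Set.mem_ofPred_eq, coe_product, Set.mem_prod] at hy
    obtain ⟨h1, h2⟩ := (Nat.chineseRemainder hmn y.1 y.2).2
    exact Prod.ext (Nat.mod_eq_of_modEq h1 hy.1.1) (Nat.mod_eq_of_modEq h2 hy.2.1)

theorem periodic_forall_of_periodic {t : Finset ℕ} {bad : ℕ → ℕ → Prop}
    (hper : ∀ p ∈ t, Function.Periodic (bad p) p) :
    Function.Periodic (fun b => ∀ p ∈ t, bad p b) (∏ p ∈ t, p) := by
  intro b
  simp only [eq_iff_iff]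
  refine forall₂_congr fun p hp => ?_
  obtain ⟨k, hk⟩ := dvd_prod_of_mem (fun p => p) hp
  rw [hk, mul_comm]
  exact ((hper p hp).nat_mul k b).to_iff

theorem card_filter_range_prod {t : Finset ℕ} (ht : ∀ p ∈ t, p.Prime) {bad : ℕ → ℕ → Prop}
    (hper : ∀ p ∈ t, Function.Periodic (bad p) p) :
    #{b ∈ range (∏ p ∈ t, p) | ∀ p ∈ t, bad p b} = ∏ p ∈ t, #{b ∈ range p | bad p b} := by
  induction t using Finset.induction_on with
  | empty => simp
  | insert p t hp ih =>
    have ht' : ∀ q ∈ t, q.Prime := fun q hq => ht q (mem_insert_of_mem hq)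
    have hper' : ∀ q ∈ t, Function.Periodic (bad q) q := fun q hq => hper q (mem_insert_of_mem hq)
    have hpp := ht p (mem_insert_self _ _)
    rw [prod_insert hp, prod_insert hp, ← ih ht' hper',
      ← card_filter_range_mul_of_coprime _ hpp.ne_zero _ (hper p (mem_insert_self _ _))
        (periodic_forall_of_periodic hper')]
    · simp only [forall_mem_insert]
    · exact Nat.Coprime.prod_right fun q hq =>
        (Nat.coprime_primes hpp (ht' q hq)).2 fun h => hp (h ▸ hq)
    · exact prod_ne_zero_iff.2 fun q hq => (ht' q hq).ne_zero

theorem card_filter_Ico_mul_of_periodic {p : ℕ → Prop} [DecidablePred p] {m : ℕ} (hp : Function.Periodic p m)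
    (k n : ℕ) : #{b ∈ Ico n (n + k * m) | p b} = k * #{b ∈ range m | p b} := by
  induction k with
  | zero => simp
  | succ k ih =>
    have h1 : Ico n (n + (k + 1) * m) = Ico n (n + k * m) ∪ Ico (n + k * m) (n + k * m + m) := by
      rw [Ico_union_Ico_eq_Ico (by omega) (by omega)]
      congr 1; ring
    rw [h1, filter_union, card_union_of_disjoint, ih, Nat.filter_Ico_card_eq_of_periodic _ _ _ hp,
      Nat.count_eq_card_filter_range]
    · ring
    · exact disjoint_filter_filter (Ico_disjoint_Ico_consecutive _ _ _)

theorem abs_card_filter_Icc_sub_le {p : ℕ → Prop} [DecidablePred p] {m : ℕ}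
    (hm : 0 < m)
    (hp : Function.Periodic p m) (X : ℕ) :
    |(#{b ∈ Icc 1 X | p b} : ℝ) - X * (#{b ∈ range m | p b} / m)| ≤ m := by
  set r := #{b ∈ range m | p b} with hr
  have hrm : r ≤ m := by simpa using card_filter_le (range m) p
  have h0 : Icc 1 X = Ico 1 (1 + X) := by ext; simp; omega
  have h1 : X / m * r ≤ #{b ∈ Icc 1 X | p b} := by
    rw [← card_filter_Ico_mul_of_periodic hp (X / m) 1, h0]
    refine card_le_card (filter_subset_filter _ (Ico_subset_Ico le_rfl ?_))
    have := Nat.div_mul_le_self X m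
    omega
  have h2 : #{b ∈ Icc 1 X | p b} ≤ (X / m + 1) * r := by
    rw [← card_filter_Ico_mul_of_periodic hp (X / m + 1) 1, h0]
    refine card_le_card (filter_subset_filter _ (Ico_subset_Ico le_rfl ?_))
    have := Nat.lt_div_mul_add (a := X) hm
    linarith
  have h1' : ((X / m : ℕ) : ℝ) * r ≤ #{b ∈ Icc 1 X | p b} := by exact_mod_cast h1
  have h2' : (#{b ∈ Icc 1 X | p b} : ℝ) ≤ ((X / m : ℕ) + 1) * r := by exact_mod_cast h2
  have hmR : (0 : ℝ) < m := by exact_mod_cast hm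
  have h3 : ((X / m : ℕ) : ℝ) ≤ X / m := Nat.cast_div_le
  have h4 : (X : ℝ) / m ≤ (X / m : ℕ) + 1 := by
    rw [div_le_iff₀ hmR]
    exact_mod_cast (by nlinarith [Nat.lt_div_mul_add (a := X) hm] : X ≤ (X / m + 1) * m)
  have hrm' : (r : ℝ) ≤ m := by exact_mod_cast hrm
  have hr0 : (0 : ℝ) ≤ r := Nat.cast_nonneg _
  have e : (X : ℝ) * (r / m) = X / m * r := by ring
  rw [e, abs_le]
  constructor <;> nlinarith

/-- Uniform sieve bound for periodic conditions indexed by primes. -/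
theorem card_sifted_le {D : Finset (Finset ℕ)} (hprime : ∀ t ∈ D, ∀ p ∈ t, p.Prime) (h0 : ∅ ∈ D)
    (hdown : ∀ t ∈ D, ∀ s ⊆ t, s ∈ D) {Q : ℕ} (hQ : ∀ t ∈ D, ∏ p ∈ t, p ≤ Q)
    {bad : ℕ → ℕ → Prop} (hper : ∀ t ∈ D, ∀ p ∈ t, Function.Periodic (bad p) p)
    (hpos : ∀ t ∈ D, ∀ p ∈ t, 0 < #{b ∈ range p | bad p b})
    (hlt : ∀ t ∈ D, ∀ p ∈ t, #{b ∈ range p | bad p b} < p) (X : ℕ) :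
    (#{b ∈ Icc 1 X | ∀ t ∈ D, ∀ p ∈ t, ¬ bad p b} : ℝ) ≤
      X / (∑ m ∈ D, ∏ p ∈ m, (#{b ∈ range p | bad p b} / p : ℝ) /
        (1 - #{b ∈ range p | bad p b} / p)) + Q ^ 6 := by
  have hcard : #D ≤ Q := by
    have : D.image (fun t => ∏ p ∈ t, p) ⊆ Icc 1 Q := by
      intro x hx
      obtain ⟨t, ht, rfl⟩ := mem_image.1 hx
      exact mem_Icc.2 ⟨Nat.one_le_iff_ne_zero.2 (prod_ne_zero_iff.2 fun q hq =>
        (hprime t ht q hq).ne_zero), hQ t ht⟩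
    have hinj : Set.InjOn (fun t : Finset ℕ => ∏ p ∈ t, p) D := by
      intro s hs t ht hst
      rw [← Nat.primeFactors_prod (hprime s hs), ← Nat.primeFactors_prod (hprime t ht)]
      exact congrArg Nat.primeFactors hst
    rw [← card_image_of_injOn hinj]
    simpa using card_le_card this
  have key := selberg_sieve (D := D) (g := fun p => (#{b ∈ range p | bad p b} / p : ℝ)) ?_ h0 hdown
    (Icc 1 X) bad X (Q * Q) Q ?_ ?_
  · refine key.trans (add_le_add le_rfl ?_)
    have : (#D : ℝ) ≤ Q := by exact_mod_cast hcard
    calc ((#D : ℝ) * Q) ^ 2 * ((Q : ℝ) * Q) ≤ ((Q : ℝ) * Q) ^ 2 * ((Q : ℝ) * Q) := by gcongr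
      _ = (Q : ℝ) ^ 6 := by ring
  · intro t ht p hp
    have hp0 : (0 : ℝ) < p := by exact_mod_cast (hprime t ht p hp).pos
    refine ⟨div_pos (by exact_mod_cast hpos t ht p hp) hp0, ?_⟩
    rw [div_lt_one hp0]
    exact_mod_cast hlt t ht p hp
  · intro t ht
    rw [← prod_inv_distrib]
    refine le_trans ?_ (Nat.cast_le.2 (hQ t ht))
    rw [Nat.cast_prod]
    refine prod_le_prod (fun p _ => by positivity) fun p hp => ?_
    rw [inv_div]
    have : (1 : ℝ) ≤ #{b ∈ range p | bad p b} := by exact_mod_cast hpos t ht p hp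
    exact div_le_self (Nat.cast_nonneg _) this
  · intro s hs t ht
    have hpr : ∀ p ∈ s ∪ t, p.Prime := fun p hp =>
      (mem_union.1 hp).elim (hprime s hs p) (hprime t ht p)
    have hpe : ∀ p ∈ s ∪ t, Function.Periodic (bad p) p := fun p hp =>
      (mem_union.1 hp).elim (hper s hs p) (hper t ht p)
    have hpos' : 0 < ∏ p ∈ s ∪ t, p := prod_pos fun p hp => (hpr p hp).pos
    have h := abs_card_filter_Icc_sub_le hpos' (periodic_forall_of_periodic hpe) X
    rw [card_filter_range_prod hpr hpe, Nat.cast_prod, Nat.cast_prod, ← prod_div_distrib] at h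
    refine h.trans ?_
    have h5 : ∏ p ∈ s ∪ t, p ≤ Q * Q := by
      have h6 : (∏ p ∈ s ∪ t, p) * ∏ p ∈ s ∩ t, p = (∏ p ∈ s, p) * ∏ p ∈ t, p :=
        prod_union_inter
      have h7 : 0 < ∏ p ∈ s ∩ t, p :=
        prod_pos fun p hp => (hprime s hs p (mem_inter.1 hp).1).pos
      calc ∏ p ∈ s ∪ t, p ≤ (∏ p ∈ s ∪ t, p) * ∏ p ∈ s ∩ t, p := Nat.le_mul_of_pos_right _ h7
        _ = (∏ p ∈ s, p) * ∏ p ∈ t, p := h6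
        _ ≤ Q * Q := Nat.mul_le_mul (hQ s hs) (hQ t ht)
    rw [← Nat.cast_prod, ← Nat.cast_mul]
    exact Nat.cast_le.2 h5

/-- The multiplicative function `∏_{p ∣ k} (1 + 1/p)`. -/
def dedekindRatio (k : ℕ) : ℝ := ∏ p ∈ k.primeFactors, (1 + 1 / (p : ℝ))

theorem one_le_prod_one_add (s : Finset ℕ) : (1 : ℝ) ≤ ∏ p ∈ s, (1 + 1 / (p : ℝ)) := by
  calc (1 : ℝ) = ∏ _p ∈ s, (1 : ℝ) := by simp
    _ ≤ _ := prod_le_prod (fun _ _ => zero_le_one) fun p _ => le_add_of_nonneg_right (by positivity)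

theorem one_le_dedekindRatio (k : ℕ) : 1 ≤ dedekindRatio k := one_le_prod_one_add _

theorem dedekindRatio_mul_le (m n : ℕ) (hm : m ≠ 0) (hn : n ≠ 0) :
    dedekindRatio (m * n) ≤ dedekindRatio m * dedekindRatio n := by
  unfold dedekindRatio
  rw [Nat.primeFactors_mul hm hn, ← prod_union_inter]
  refine le_mul_of_one_le_right (prod_nonneg fun p _ => by positivity) (one_le_prod_one_add _)

theorem dedekindRatio_prime_pow {p k : ℕ} (hp : p.Prime) (hk : k ≠ 0) :
    dedekindRatio (p ^ k) = 1 + 1 / p := by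
  rw [dedekindRatio, Nat.primeFactors_pow _ hk, hp.primeFactors, prod_singleton]

theorem sum_inv_sq_Icc_le (n : ℕ) (hn : 1 ≤ n) :
    ∑ r ∈ Icc 1 n, 1 / (r : ℝ) ^ 2 ≤ 2 - 1 / (n : ℝ) := by
  induction n, hn using Nat.le_induction with
  | base => norm_num
  | succ n hn ih =>
    rw [sum_Icc_succ_top (by omega)]
    have h : (0 : ℝ) < n := by exact_mod_cast hn
    have : 1 / ((n + 1 : ℕ) : ℝ) ^ 2 ≤ 1 / n - 1 / (n + 1 : ℕ) := by
      push_cast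
      rw [div_sub_div _ _ h.ne' (by positivity), div_le_div_iff₀ (by positivity) (by positivity)]
      nlinarith
    linarith

/-- Finite sets of primes up to `Y` not dividing `k`, with product at most `Z`. -/
def primeSets (k Y Z : ℕ) : Finset (Finset ℕ) :=
  {t ∈ ({p ∈ range (Y + 1) | p.Prime ∧ ¬ p ∣ k} : Finset ℕ).powerset | ∏ p ∈ t, p ≤ Z}

theorem mem_primeSets {k Y Z : ℕ} {t : Finset ℕ} :
    t ∈ primeSets k Y Z ↔ (∀ p ∈ t, p ≤ Y ∧ p.Prime ∧ ¬ p ∣ k) ∧ ∏ p ∈ t, p ≤ Z := by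
  simp only [primeSets, mem_filter, mem_powerset, subset_iff, mem_range, Nat.lt_succ_iff]

theorem log_le_sum_primeSets {k Y : ℕ} (hk : k ≠ 0) :
    Real.log Y ≤ 2 * dedekindRatio k * ∑ u ∈ primeSets k Y Y, ∏ p ∈ u, 1 / (p : ℝ) := by
  rcases Nat.eq_zero_or_pos Y with rfl | hY
  · simp only [Nat.cast_zero, Real.log_zero]
    have := one_le_dedekindRatio k
    refine mul_nonneg (by linarith) (sum_nonneg fun u _ => prod_nonneg fun p _ => by positivity)
  set T := Icc 1 Y ×ˢ k.primeFactors.powerset ×ˢ primeSets k Y Y with hT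
  let f : ℕ × Finset ℕ × Finset ℕ → ℕ := fun x => x.1 ^ 2 * ((∏ p ∈ x.2.1, p) * ∏ p ∈ x.2.2, p)
  have h1 : Icc 1 Y ⊆ T.image f := by
    intro m hm
    obtain ⟨hm1, hmY⟩ := mem_Icc.1 hm
    obtain ⟨s, r, hrs, hs⟩ := Nat.sq_mul_squarefree m
    have hs0 : s ≠ 0 := hs.ne_zero
    have hr0 : r ≠ 0 := by rintro rfl; simp at hrs; omega
    have hsm : s ∣ m := ⟨r ^ 2, by rw [← hrs]; ring⟩
    have hrm : r ∣ m := ⟨r * s, by rw [← hrs]; ring⟩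
    refine mem_image.2 ⟨(r, s.primeFactors.filter (· ∣ k), s.primeFactors.filter (¬ · ∣ k)), ?_, ?_⟩
    · simp only [hT, mem_product, mem_Icc, mem_powerset, mem_primeSets]
      refine ⟨⟨Nat.one_le_iff_ne_zero.2 hr0, (Nat.le_of_dvd hm1 hrm).trans hmY⟩, ?_, ?_, ?_⟩
      · intro p hp
        obtain ⟨hp, hpk⟩ := mem_filter.1 hp
        exact Nat.mem_primeFactors.2 ⟨(Nat.mem_primeFactors.1 hp).1, hpk, hk⟩
      · intro p hp
        obtain ⟨hp, hpk⟩ := mem_filter.1 hp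
        obtain ⟨hp1, hp2, -⟩ := Nat.mem_primeFactors.1 hp
        exact ⟨(Nat.le_of_dvd hm1 (hp2.trans hsm)).trans hmY, hp1, hpk⟩
      · refine le_trans ?_ ((Nat.le_of_dvd hm1 hsm).trans hmY)
        conv_rhs => rw [← Nat.prod_primeFactors_of_squarefree hs]
        exact prod_le_prod_of_subset_of_one_le' (filter_subset _ _)
          fun p hp _ => (Nat.prime_of_mem_primeFactors hp).one_le
    · simp only [f]
      rw [prod_filter_mul_prod_filter_not, Nat.prod_primeFactors_of_squarefree hs, hrs]
  have h2 : Real.log Y ≤ ∑ m ∈ Icc 1 Y, 1 / (m : ℝ) := by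
    have h := log_add_one_le_harmonic Y
    rw [harmonic_eq_sum_Icc] at h
    push_cast at h
    simp only [one_div]
    refine le_trans (Real.log_le_log (by exact_mod_cast hY) ?_) h
    linarith
  have h3 : ∑ m ∈ Icc 1 Y, 1 / (m : ℝ) ≤ ∑ x ∈ T, 1 / (f x : ℝ) := by
    refine le_trans (sum_le_sum_of_subset_of_nonneg h1 fun m _ _ => by positivity) ?_
    exact sum_image_le_of_nonneg (f := fun m : ℕ => 1 / (m : ℝ)) fun m _ => by positivity
  have h4 : ∑ x ∈ T, 1 / (f x : ℝ) = (∑ r ∈ Icc 1 Y, 1 / (r : ℝ) ^ 2) *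
      (dedekindRatio k * ∑ u ∈ primeSets k Y Y, ∏ p ∈ u, 1 / (p : ℝ)) := by
    rw [dedekindRatio, prod_one_add, sum_mul_sum, ← sum_product', sum_mul_sum, ← sum_product']
    refine sum_congr rfl fun x _ => ?_
    simp only [f, Nat.cast_mul, Nat.cast_pow, Nat.cast_prod, one_div, mul_inv, prod_inv_distrib]
  have h5 := sum_inv_sq_Icc_le Y hY
  have h6 : (0 : ℝ) ≤ 1 / Y := by positivity
  have h7 : 0 ≤ dedekindRatio k * ∑ u ∈ primeSets k Y Y, ∏ p ∈ u, 1 / (p : ℝ) :=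
    mul_nonneg (by linarith [one_le_dedekindRatio k])
      (sum_nonneg fun u _ => prod_nonneg fun p _ => by positivity)
  calc Real.log Y ≤ _ := h2.trans (h3.trans h4.le)
    _ ≤ 2 * (dedekindRatio k * ∑ u ∈ primeSets k Y Y, ∏ p ∈ u, 1 / (p : ℝ)) :=
      mul_le_mul_of_nonneg_right (by linarith) h7
    _ = _ := by ring

theorem sum_le_sum_of_mapsTo_injOn {α β : Type*} {s : Finset α} {t : Finset β} {f : α → ℝ}
    {g : β → ℝ} (e : α → β) (hmaps : ∀ x ∈ s, e x ∈ t) (hinj : Set.InjOn e s)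
    (hfg : ∀ x ∈ s, f x ≤ g (e x)) (hg : ∀ y ∈ t, 0 ≤ g y) : ∑ x ∈ s, f x ≤ ∑ y ∈ t, g y := by
  refine (sum_le_sum hfg).trans ?_
  rw [← sum_image (f := g) hinj]
  exact sum_le_sum_of_subset_of_nonneg (image_subset_iff.2 hmaps) fun y hy _ => hg y hy

theorem sum_prod_mul_sum_prod_le {ι : Type*} [DecidableEq ι] {D₁ D₂ D : Finset (Finset ι)}
    {f₁ f₂ : ι → ℝ} (h₁ : ∀ i, 0 ≤ f₁ i) (h₂ : ∀ i, 0 ≤ f₂ i)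
    (hD : ∀ u ∈ D₁, ∀ v ∈ D₂, u ∪ v ∈ D) :
    (∑ u ∈ D₁, ∏ i ∈ u, f₁ i) * (∑ v ∈ D₂, ∏ i ∈ v, f₂ i) ≤
      ∑ t ∈ D, ∏ i ∈ t, (f₁ i + f₂ i + f₁ i * f₂ i) := by
  have hn₁ : ∀ u : Finset ι, 0 ≤ ∏ i ∈ u, f₁ i := fun u => prod_nonneg fun i _ => h₁ i
  have hn₂ : ∀ u : Finset ι, 0 ≤ ∏ i ∈ u, f₂ i := fun u => prod_nonneg fun i _ => h₂ i
  rw [sum_mul_sum, ← sum_product', ← sum_fiberwise_of_maps_to (t := D)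
    (g := fun x : Finset ι × Finset ι => x.1 ∪ x.2)
    (fun x hx => hD _ (mem_product.1 hx).1 _ (mem_product.1 hx).2)]
  refine sum_le_sum fun t _ => ?_
  have e : ∏ i ∈ t, (f₁ i + f₂ i + f₁ i * f₂ i) =
      ∑ v ∈ t.powerset, ∑ w ∈ v.powerset, (∏ i ∈ w ∪ (t \ v), f₁ i) * ∏ i ∈ v, f₂ i := by
    calc ∏ i ∈ t, (f₁ i + f₂ i + f₁ i * f₂ i) = ∏ i ∈ t, (f₂ i * (1 + f₁ i) + f₁ i) :=
          prod_congr rfl fun i _ => by ring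
      _ = _ := by
        rw [prod_add]
        refine sum_congr rfl fun v hv => ?_
        rw [prod_mul_distrib, prod_one_add, mul_sum, sum_mul]
        refine sum_congr rfl fun w hw => ?_
        rw [prod_union (disjoint_of_subset_left (mem_powerset.1 hw) disjoint_sdiff)]
        ring
  rw [e, sum_sigma']
  have hrec : ∀ x : Finset ι × Finset ι, x.1 ∪ x.2 = t → x.1 ∩ x.2 ∪ t \ x.2 = x.1 := by
    rintro x rfl
    ext i
    simp only [mem_union, mem_inter, mem_sdiff]
    tauto
  refine sum_le_sum_of_mapsTo_injOn
    (fun x : Finset ι × Finset ι => (⟨x.2, x.1 ∩ x.2⟩ : (_ : Finset ι) × Finset ι)) ?_ ?_ ?_ ?_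
  · intro x hx
    obtain ⟨-, rfl⟩ := mem_filter.1 hx
    exact mem_sigma.2 ⟨mem_powerset.2 subset_union_right, mem_powerset.2 inter_subset_right⟩
  · intro x hx y hy hxy
    obtain ⟨-, hx⟩ := mem_filter.1 (mem_coe.1 hx)
    obtain ⟨-, hy⟩ := mem_filter.1 (mem_coe.1 hy)
    simp only [Sigma.mk.injEq, heq_eq_eq] at hxy
    refine Prod.ext ?_ hxy.1
    rw [← hrec x hx, ← hrec y hy, hxy.1, ← hxy.2, hxy.1]
  · intro x hx
    obtain ⟨-, hx⟩ := mem_filter.1 hx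
    simp only [hrec x hx, le_refl]
  · intro y _
    exact mul_nonneg (hn₁ _) (hn₂ _)

theorem exists_range_filter_modEq_eq_singleton {p a : ℕ} (hp : p.Prime) (ha : ¬ p ∣ a) (r : ℕ) :
    ∃ x, ({b ∈ range p | a * b + 1 ≡ r [MOD p]} : Finset ℕ) = {x} := by
  have := Fact.mk hp
  have ha' : (a : ZMod p) ≠ 0 := by rwa [Ne, ZMod.natCast_eq_zero_iff]
  refine ⟨(((r : ZMod p) - 1) / a).val, ?_⟩
  ext b
  simp only [mem_filter, mem_range, mem_singleton]
  rw [← ZMod.natCast_eq_natCast_iff]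
  push_cast
  constructor
  · rintro ⟨hb, h⟩
    have : ((r : ZMod p) - 1) / a = b := by
      rw [div_eq_iff ha', ← h]
      ring
    rw [this, ZMod.val_natCast, Nat.mod_eq_of_lt hb]
  · rintro rfl
    refine ⟨ZMod.val_lt _, ?_⟩
    rw [ZMod.natCast_val, ZMod.cast_id', id, mul_div_cancel₀ _ ha']
    ring

theorem card_range_filter_dvd_or_modEq {p a : ℕ} (hp : p.Prime) (ha : ¬ p ∣ a) (n : ℕ) :
    #{b ∈ range p | p ∣ a * b + 1 ∨ a * b + 1 ≡ n [MOD p]} = if p ∣ n then 1 else 2 := by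
  obtain ⟨x, hx⟩ := exists_range_filter_modEq_eq_singleton hp ha 0
  obtain ⟨y, hy⟩ := exists_range_filter_modEq_eq_singleton hp ha n
  simp only [Nat.modEq_zero_iff_dvd] at hx
  rw [filter_or, hx, hy]
  have hx' := (mem_filter.1 (hx.symm ▸ mem_singleton_self x)).2
  have hy' := (mem_filter.1 (hy.symm ▸ mem_singleton_self y)).2
  split_ifs with h
  · have : x = y := by
      rw [← mem_singleton, ← hy, mem_filter]
      refine ⟨(mem_filter.1 (hx.symm ▸ mem_singleton_self x)).1, ?_⟩
      exact (Nat.modEq_zero_iff_dvd.2 hx').trans (Nat.modEq_zero_iff_dvd.2 h).symm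
    rw [this, union_self, card_singleton]
  · have : x ≠ y := by
      rintro rfl
      exact h (Nat.modEq_zero_iff_dvd.1 (hy'.symm.trans (Nat.modEq_zero_iff_dvd.2 hx')))
    rw [← insert_eq, card_pair this]

theorem primeSets_mono {k k' Y Z Z' : ℕ} (hk : k ∣ k') (hZ : Z ≤ Z') :
    primeSets k' Y Z ⊆ primeSets k Y Z' := by
  intro t ht
  rw [mem_primeSets] at ht ⊢
  exact ⟨fun p hp => ⟨(ht.1 p hp).1, (ht.1 p hp).2.1, fun h => (ht.1 p hp).2.2 (h.trans hk)⟩,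
    ht.2.trans hZ⟩

theorem three_le_of_not_dvd_two_mul {p a : ℕ} (hp : p.Prime) (h : ¬ p ∣ 2 * a) : 3 ≤ p := by
  rcases hp.two_le.eq_or_lt with h' | h'
  · exact absurd (h' ▸ dvd_mul_right _ _) h
  · exact h'

theorem sieve_factor_ge {p : ℕ} (hp : 3 ≤ p) (q : Prop) [Decidable q] :
    1 / (p : ℝ) + (if q then 0 else 1 / (p : ℝ)) + 1 / p * (if q then 0 else 1 / (p : ℝ)) ≤
      (((if q then 1 else 2 : ℕ) : ℝ) / p) / (1 - ((if q then 1 else 2 : ℕ) : ℝ) / p) := by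
  have hp' : (3 : ℝ) ≤ p := by exact_mod_cast hp
  have hp0 : (p : ℝ) ≠ 0 := by positivity
  split_ifs with h
  · have e : ((1 : ℕ) : ℝ) / p / (1 - ((1 : ℕ) : ℝ) / p) = 1 / (p - 1) := by
      have : (p : ℝ) - 1 ≠ 0 := by linarith
      push_cast
      field_simp
    rw [e, mul_zero, add_zero, add_zero]
    exact one_div_le_one_div_of_le (by linarith) (by linarith)
  · have e : ((2 : ℕ) : ℝ) / p / (1 - ((2 : ℕ) : ℝ) / p) = 2 / (p - 2) := by
      have : (p : ℝ) - 2 ≠ 0 := by linarith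
      push_cast
      field_simp
    have e' : 1 / (p : ℝ) + 1 / p + 1 / p * (1 / p) = (2 * p + 1) / p ^ 2 := by
      field_simp
      ring
    rw [e, e', div_le_div_iff₀ (by positivity) (by linarith)]
    nlinarith

theorem log_sq_le_sum_primeSets {a n Y : ℕ} (ha : a ≠ 0) (hn : n ≠ 0) :
    Real.log Y ^ 2 ≤ 9 * dedekindRatio a ^ 2 * dedekindRatio n *
      ∑ t ∈ primeSets (2 * a) Y (Y ^ 2), ∏ p ∈ t,
        (((if p ∣ n then 1 else 2 : ℕ) : ℝ) / p) / (1 - ((if p ∣ n then 1 else 2 : ℕ) : ℝ) / p) := by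
  have h1 := log_le_sum_primeSets (k := 2 * a) (Y := Y) (by positivity)
  have h2 := log_le_sum_primeSets (k := 2 * a * n) (Y := Y) (by positivity)
  have hY : 0 ≤ Real.log Y := Real.log_natCast_nonneg Y
  set S₁ := ∑ u ∈ primeSets (2 * a) Y Y, ∏ p ∈ u, 1 / (p : ℝ) with hS₁
  set S₂ := ∑ u ∈ primeSets (2 * a * n) Y Y, ∏ p ∈ u, 1 / (p : ℝ) with hS₂
  have hS₁0 : 0 ≤ S₁ := sum_nonneg fun u _ => prod_nonneg fun p _ => by positivity
  have hS₂0 : 0 ≤ S₂ := sum_nonneg fun u _ => prod_nonneg fun p _ => by positivity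
  have hψa := one_le_dedekindRatio a
  have hψn := one_le_dedekindRatio n
  have hψ2 : dedekindRatio 2 = 3 / 2 := by
    have := dedekindRatio_prime_pow Nat.prime_two one_ne_zero
    rw [pow_one] at this
    rw [this]
    norm_num
  have h3 : dedekindRatio (2 * a) ≤ 3 / 2 * dedekindRatio a :=
    hψ2 ▸ dedekindRatio_mul_le 2 a two_ne_zero ha
  have h4 : dedekindRatio (2 * a * n) ≤ 3 / 2 * dedekindRatio a * dedekindRatio n :=
    (dedekindRatio_mul_le (2 * a) n (by positivity) hn).trans
      (mul_le_mul_of_nonneg_right h3 (by linarith))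
  have key : S₁ * S₂ ≤ ∑ t ∈ primeSets (2 * a) Y (Y ^ 2), ∏ p ∈ t,
        (((if p ∣ n then 1 else 2 : ℕ) : ℝ) / p) /
          (1 - ((if p ∣ n then 1 else 2 : ℕ) : ℝ) / p) := by
    have e : S₂ = ∑ v ∈ primeSets (2 * a * n) Y Y,
        ∏ p ∈ v, if p ∣ n then 0 else 1 / (p : ℝ) := by
      refine sum_congr rfl fun v hv => prod_congr rfl fun p hp => ?_
      rw [if_neg fun h => ((mem_primeSets.1 hv).1 p hp).2.2 (h.mul_left _)]
    rw [e, hS₁]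
    refine (sum_prod_mul_sum_prod_le (D := primeSets (2 * a) Y (Y ^ 2))
      (f₁ := fun p : ℕ => 1 / (p : ℝ)) (f₂ := fun p : ℕ => if p ∣ n then 0 else 1 / (p : ℝ))
      (fun p => by positivity) (fun p => by split_ifs <;> positivity) ?_).trans ?_
    · intro u hu v hv
      have hv' := primeSets_mono (k := 2 * a) (dvd_mul_right _ n) le_rfl hv
      rw [mem_primeSets] at hu hv' ⊢
      refine ⟨fun p hp => (mem_union.1 hp).elim (hu.1 p) (hv'.1 p), ?_⟩
      calc ∏ p ∈ u ∪ v, p ≤ (∏ p ∈ u ∪ v, p) * ∏ p ∈ u ∩ v, p :=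
            Nat.le_mul_of_pos_right _ (prod_pos fun p hp => (hu.1 p (mem_inter.1 hp).1).2.1.pos)
        _ = (∏ p ∈ u, p) * ∏ p ∈ v, p := prod_union_inter
        _ ≤ Y * Y := Nat.mul_le_mul hu.2 hv'.2
        _ = Y ^ 2 := (sq Y).symm
    · refine sum_le_sum fun t ht => ?_
      refine prod_le_prod ?_ ?_
      · intro p _
        have h0 : (0 : ℝ) ≤ if p ∣ n then 0 else 1 / (p : ℝ) := by split_ifs <;> positivity
        exact add_nonneg (add_nonneg (by positivity) h0) (mul_nonneg (by positivity) h0)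
      · intro p hp
        obtain ⟨-, hp1, hp2⟩ := (mem_primeSets.1 ht).1 p hp
        exact sieve_factor_ge (three_le_of_not_dvd_two_mul hp1 hp2) _
  clear_value S₁ S₂
  calc Real.log Y ^ 2 = Real.log Y * Real.log Y := sq _
    _ ≤ (2 * dedekindRatio (2 * a) * S₁) * (2 * dedekindRatio (2 * a * n) * S₂) :=
        mul_le_mul h1 h2 hY (hY.trans h1)
    _ ≤ (2 * (3 / 2 * dedekindRatio a) * S₁) *
          (2 * (3 / 2 * dedekindRatio a * dedekindRatio n) * S₂) := by
        have := one_le_dedekindRatio (2 * a * n)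
        gcongr
    _ = 9 * dedekindRatio a ^ 2 * dedekindRatio n * (S₁ * S₂) := by ring
    _ ≤ _ := mul_le_mul_of_nonneg_left key (by positivity)

theorem card_prime_pairs_le {a n Y : ℕ} (hYa : Y ≤ a) (hY : 2 ≤ Y) (hn : n ≠ 0) (X : ℕ) :
    (#{b ∈ Icc 1 X | (a * b + 1).Prime ∧ a * b + 1 < n ∧ (n - (a * b + 1)).Prime} : ℝ) ≤
      9 * X * dedekindRatio a ^ 2 * dedekindRatio n / Real.log Y ^ 2 + (Y ^ 12 + Y + 1) := by
  have ha : a ≠ 0 := by omega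
  have hlog : 0 < Real.log Y := Real.log_pos (by exact_mod_cast hY)
  set D := primeSets (2 * a) Y (Y ^ 2) with hD
  obtain ⟨bad, hbad⟩ : ∃ bad : ℕ → ℕ → Prop,
      ∀ p b, bad p b ↔ p ∣ a * b + 1 ∨ a * b + 1 ≡ n [MOD p] :=
    ⟨fun p b => p ∣ a * b + 1 ∨ a * b + 1 ≡ n [MOD p], fun _ _ => Iff.rfl⟩
  have hD1 : ∀ t ∈ D, ∀ p ∈ t, p ≤ Y ∧ p.Prime ∧ ¬ p ∣ 2 * a := fun t ht =>
    (mem_primeSets.1 ht).1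
  have hcard : ∀ t ∈ D, ∀ p ∈ t, #{b ∈ range p | bad p b} = if p ∣ n then 1 else 2 := by
    intro t ht p hp
    rw [filter_congr fun b _ => hbad p b]
    exact card_range_filter_dvd_or_modEq (hD1 t ht p hp).2.1
      (fun h => (hD1 t ht p hp).2.2 (h.mul_left 2)) n
  have hsift := card_sifted_le (D := D) (fun t ht p hp => (hD1 t ht p hp).2.1) (by
      rw [hD, mem_primeSets]
      refine ⟨fun p hp => absurd hp (notMem_empty p), ?_⟩
      rw [prod_empty]
      exact Nat.one_le_pow _ _ (by omega)) (by
      intro t ht s hs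
      rw [hD, mem_primeSets] at ht ⊢
      refine ⟨fun p hp => ht.1 p (hs hp), le_trans ?_ ht.2⟩
      exact prod_le_prod_of_subset_of_one_le' hs fun p hp _ => (ht.1 p hp).2.1.one_le)
    (Q := Y ^ 2) (fun t ht => (mem_primeSets.1 ht).2) (bad := bad) (by
      intro t ht p hp b
      simp only [hbad, mul_add, eq_iff_iff]
      have e : a * b + a * p + 1 ≡ a * b + 1 [MOD p] := by
        rw [add_right_comm]
        exact Nat.add_mul_mod_self_right _ _ _
      refine or_congr ?_ ⟨fun h => e.symm.trans h, fun h => e.trans h⟩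
      exact e.dvd_iff dvd_rfl) (by
      intro t ht p hp
      rw [hcard t ht p hp]
      split_ifs <;> norm_num) (by
      intro t ht p hp
      rw [hcard t ht p hp]
      obtain ⟨-, hp1, hp2⟩ := hD1 t ht p hp
      have hp3 := three_le_of_not_dvd_two_mul hp1 hp2
      split_ifs <;> omega) X
  have hS := log_sq_le_sum_primeSets (Y := Y) ha hn
  have hSe : ∑ m ∈ D, ∏ p ∈ m, (#{b ∈ range p | bad p b} / p : ℝ) /
      (1 - #{b ∈ range p | bad p b} / p) = ∑ t ∈ D, ∏ p ∈ t,
        (((if p ∣ n then 1 else 2 : ℕ) : ℝ) / p) /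
          (1 - ((if p ∣ n then 1 else 2 : ℕ) : ℝ) / p) := by
    refine sum_congr rfl fun t ht => prod_congr rfl fun p hp => ?_
    rw [hcard t ht p hp]
  rw [hSe] at hsift
  set S := ∑ t ∈ D, ∏ p ∈ t, (((if p ∣ n then 1 else 2 : ℕ) : ℝ) / p) /
          (1 - ((if p ∣ n then 1 else 2 : ℕ) : ℝ) / p) with hSdef
  have hψa := one_le_dedekindRatio a
  have hψn := one_le_dedekindRatio n
  have hψ : 0 < 9 * dedekindRatio a ^ 2 * dedekindRatio n := by positivity
  have hSpos : 0 < S := by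
    by_contra h
    have := mul_nonpos_of_nonneg_of_nonpos hψ.le (not_lt.1 h)
    have := pow_pos hlog 2
    linarith
  have hXS : X / S ≤ 9 * X * dedekindRatio a ^ 2 * dedekindRatio n / Real.log Y ^ 2 := by
    rw [div_le_div_iff₀ hSpos (by positivity)]
    calc X * Real.log Y ^ 2 ≤ X * (9 * dedekindRatio a ^ 2 * dedekindRatio n * S) := by gcongr
      _ = _ := by ring
  have hsub : ({b ∈ Icc 1 X | (a * b + 1).Prime ∧ a * b + 1 < n ∧ (n - (a * b + 1)).Prime} :
      Finset ℕ) ⊆ {b ∈ Icc 1 X | ∀ t ∈ D, ∀ p ∈ t, ¬ bad p b} ∪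
        {b ∈ Icc 1 X | a * b + 1 < n ∧ n - (a * b + 1) ≤ Y} := by
    intro b hb
    obtain ⟨hbX, hp1, hlt, hp2⟩ := mem_filter.1 hb
    rw [mem_union, mem_filter, mem_filter]
    by_cases h : n - (a * b + 1) ≤ Y
    · exact Or.inr ⟨hbX, hlt, h⟩
    · refine Or.inl ⟨hbX, fun t ht p hp hb' => ?_⟩
      obtain ⟨hpY, hpp, -⟩ := hD1 t ht p hp
      have hb1 : 1 ≤ b := (mem_Icc.1 hbX).1
      rcases (hbad p b).1 hb' with hb' | hb'
      · have := (Nat.prime_dvd_prime_iff_eq hpp hp1).1 hb'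
        have : a ≤ a * b := Nat.le_mul_of_pos_right a hb1
        omega
      · have h' := (Nat.modEq_iff_dvd' hlt.le).1 hb'
        have := (Nat.prime_dvd_prime_iff_eq hpp hp2).1 h'
        omega
  have hexc : #{b ∈ Icc 1 X | a * b + 1 < n ∧ n - (a * b + 1) ≤ Y} ≤ Y + 1 := by
    rw [← card_range (Y + 1)]
    refine card_le_card_of_injOn (fun b => n - (a * b + 1)) ?_ ?_
    · intro b hb
      have := (mem_filter.1 (mem_coe.1 hb)).2
      simp only [coe_range, Set.mem_Iio]
      omega
    · intro b hb b' hb' h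
      have h1 := (mem_filter.1 (mem_coe.1 hb)).2
      have h2 := (mem_filter.1 (mem_coe.1 hb')).2
      have : a * b = a * b' := by
        simp only at h
        omega
      exact Nat.eq_of_mul_eq_mul_left (Nat.pos_of_ne_zero ha) this
  have hc := (card_le_card hsub).trans (card_union_le _ _)
  have hc' : (#{b ∈ Icc 1 X | (a * b + 1).Prime ∧ a * b + 1 < n ∧ (n - (a * b + 1)).Prime} : ℝ) ≤
      #{b ∈ Icc 1 X | ∀ t ∈ D, ∀ p ∈ t, ¬ bad p b} + (Y + 1 : ℕ) := by
    exact_mod_cast hc.trans (Nat.add_le_add_left hexc _)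
  push_cast at hc' hsift
  rw [← pow_mul] at hsift
  norm_num at hsift
  linarith

open ArithmeticFunction in
theorem sum_vonMangoldt_mul_div_eq_log_factorial (k : ℕ) :
    ∑ d ∈ Ioc 0 k, vonMangoldt d * ((k / d : ℕ) : ℝ) = Real.log (k.factorial) := by
  rw [← sum_Ioc_mul_zeta_eq_sum, vonMangoldt_mul_zeta]
  induction k with
  | zero => simp
  | succ k ih =>
    rw [← insert_Ioc_right_eq_Ioc_add_one (Nat.zero_le k), sum_insert (by simp), ih,
      Nat.factorial_succ, Nat.cast_mul, Real.log_mul (by positivity) (by positivity), log_apply]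

/-- The partial sums of `Λ(d) / d`. -/
def mangoldtSum (k : ℕ) : ℝ := ∑ d ∈ Ioc 0 k, ArithmeticFunction.vonMangoldt d / (d : ℝ)

theorem mangoldtSum_le {k : ℕ} (hk : 1 ≤ k) : mangoldtSum k ≤ Real.log k + 6 := by
  have hk0 : (0 : ℝ) < k := by exact_mod_cast hk
  have h1 := sum_vonMangoldt_mul_div_eq_log_factorial k
  have h2 : ∑ d ∈ Ioc 0 k, ArithmeticFunction.vonMangoldt d * ((k : ℝ) / d - 1) ≤
      ∑ d ∈ Ioc 0 k, ArithmeticFunction.vonMangoldt d * ((k / d : ℕ) : ℝ) := by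
    refine sum_le_sum fun d hd => mul_le_mul_of_nonneg_left ?_
      ArithmeticFunction.vonMangoldt_nonneg
    have := Nat.lt_floor_add_one ((k : ℝ) / d)
    rw [Nat.floor_div_eq_div] at this
    linarith
  have h3 : ∑ d ∈ Ioc 0 k, ArithmeticFunction.vonMangoldt d * ((k : ℝ) / d - 1) =
      k * mangoldtSum k - Chebyshev.psi k := by
    rw [mangoldtSum, Chebyshev.psi, Nat.floor_natCast, mul_sum, ← sum_sub_distrib]
    exact sum_congr rfl fun d _ => by ring
  have h4 := Chebyshev.psi_le_const_mul_self hk0.le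
  have h5 : Real.log k.factorial ≤ k * Real.log k := by
    rw [← Real.log_pow]
    exact Real.log_le_log (by positivity) (by exact_mod_cast Nat.factorial_le_pow k)
  have h6 : Real.log 4 ≤ 2 := by
    rw [show (4 : ℝ) = 2 ^ 2 by norm_num, Real.log_pow]
    have := Real.log_two_lt_d9
    push_cast
    linarith
  have h7 : k * mangoldtSum k ≤ k * (Real.log k + 6) := by nlinarith
  exact le_of_mul_le_mul_left h7 hk0

theorem le_mangoldtSum {k : ℕ} (hk : 1 ≤ k) : Real.log k - 1 ≤ mangoldtSum k := by
  have hk0 : (0 : ℝ) < k := by exact_mod_cast hk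
  have h1 := sum_vonMangoldt_mul_div_eq_log_factorial k
  have h2 : ∑ d ∈ Ioc 0 k, ArithmeticFunction.vonMangoldt d * ((k / d : ℕ) : ℝ) ≤
      k * mangoldtSum k := by
    rw [mangoldtSum, mul_sum]
    refine sum_le_sum fun d hd => ?_
    calc _ ≤ ArithmeticFunction.vonMangoldt d * ((k : ℝ) / d) :=
          mul_le_mul_of_nonneg_left Nat.cast_div_le ArithmeticFunction.vonMangoldt_nonneg
      _ = _ := by ring
  have h3 := Stirling.le_log_factorial_stirling (n := k) (by omega)
  have h4 : 0 ≤ Real.log k := Real.log_natCast_nonneg k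
  have h5 : 0 ≤ Real.log (2 * Real.pi) := Real.log_nonneg (by linarith [Real.pi_gt_three])
  have h7 : k * (Real.log k - 1) ≤ k * mangoldtSum k := by linarith
  exact le_of_mul_le_mul_left h7 hk0

theorem sum_vonMangoldt_div_Ioc_le {x y : ℝ} (hx : 0 < x) (hxy : x ≤ y) (hy : 1 ≤ y) :
    ∑ q ∈ Ioc ⌊x⌋₊ ⌊y⌋₊, ArithmeticFunction.vonMangoldt q / (q : ℝ) ≤ Real.log (y / x) + 8 := by
  have h1 : mangoldtSum ⌊y⌋₊ = mangoldtSum ⌊x⌋₊ +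
      ∑ q ∈ Ioc ⌊x⌋₊ ⌊y⌋₊, ArithmeticFunction.vonMangoldt q / (q : ℝ) :=
    (sum_Ioc_consecutive _ (Nat.zero_le _) (Nat.floor_le_floor hxy)).symm
  have h2 : mangoldtSum ⌊y⌋₊ ≤ Real.log y + 6 := by
    refine (mangoldtSum_le (Nat.one_le_floor_iff y |>.2 hy)).trans ?_
    have := Real.log_le_log (by exact_mod_cast (Nat.one_le_floor_iff y |>.2 hy))
      (Nat.floor_le (by linarith : 0 ≤ y))
    linarith
  have h3 : Real.log x - 2 ≤ mangoldtSum ⌊x⌋₊ := by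
    rcases lt_or_ge x 1 with h | h
    · have h0 : 0 ≤ mangoldtSum ⌊x⌋₊ := sum_nonneg fun d _ =>
        div_nonneg ArithmeticFunction.vonMangoldt_nonneg (Nat.cast_nonneg _)
      have := Real.log_nonpos hx.le h.le
      linarith
    · have hf : 1 ≤ ⌊x⌋₊ := (Nat.one_le_floor_iff x).2 h
      have hf' : (1 : ℝ) ≤ ⌊x⌋₊ := by exact_mod_cast hf
      refine le_trans ?_ (le_mangoldtSum hf)
      have h5 : x ≤ 2 * ⌊x⌋₊ := by
        have := Nat.lt_floor_add_one x
        linarith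
      have h6 := Real.log_le_log hx h5
      rw [Real.log_mul two_ne_zero (by positivity)] at h6
      have := Real.log_two_lt_d9
      linarith
  rw [Real.log_div (by linarith) hx.ne']
  linarith

theorem sum_vonMangoldt_div_mul_log_le {k : ℕ} (hk : 2 ≤ k) :
    ∑ q ∈ Ioc 1 k, ArithmeticFunction.vonMangoldt q / ((q : ℝ) * Real.log q) ≤
      mangoldtSum k / Real.log k + Real.log (Real.log k) - 6 / Real.log k +
        (6 / Real.log 2 - Real.log (Real.log 2)) := by
  induction k, hk using Nat.le_induction with
  | base =>
    rw [show Ioc 1 2 = {2} by rfl, sum_singleton, mangoldtSum, show Ioc 0 2 = {1, 2} by rfl,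
      sum_pair (by norm_num), ArithmeticFunction.vonMangoldt_apply_one]
    push_cast
    rw [zero_div, zero_add, div_div]
    linarith
  | succ k hk ih =>
    have hk' : (2 : ℝ) ≤ k := by exact_mod_cast hk
    have hlog : 0 < Real.log k := Real.log_pos (by linarith)
    have hlog' : Real.log k ≤ Real.log (k + 1 : ℕ) :=
      Real.log_le_log (by linarith) (by push_cast; linarith)
    have hM := mangoldtSum_le (k := k) (by omega)
    have e1 : mangoldtSum (k + 1) = mangoldtSum k +
        ArithmeticFunction.vonMangoldt (k + 1) / ((k + 1 : ℕ) : ℝ) := by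
      rw [mangoldtSum, ← insert_Ioc_right_eq_Ioc_add_one (Nat.zero_le k), sum_insert (by simp),
        add_comm, mangoldtSum]
    rw [← insert_Ioc_right_eq_Ioc_add_one (by omega : 1 ≤ k), sum_insert (by simp), e1, add_div,
      div_div]
    set u := Real.log k
    set v := Real.log (k + 1 : ℕ)
    have hv : 0 < v := hlog.trans_le hlog'
    have h2 : 1 - u / v ≤ Real.log v - Real.log u := by
      rw [← Real.log_div hv.ne' hlog.ne']
      have := Real.one_sub_inv_le_log_of_pos (div_pos hv hlog)
      rwa [inv_div] at this
    have h3 : (mangoldtSum k - 6) * (1 / u - 1 / v) ≤ u * (1 / u - 1 / v) := by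
      refine mul_le_mul_of_nonneg_right (by linarith) ?_
      exact sub_nonneg.2 (one_div_le_one_div_of_le hlog hlog')
    have h4 : u * (1 / u - 1 / v) = 1 - u / v := by
      field_simp
    have h5 : (mangoldtSum k - 6) * (1 / u - 1 / v) =
      mangoldtSum k / u - mangoldtSum k / v - 6 / u + 6 / v := by ring
    linarith

theorem exists_sum_primes_inv_le : ∃ C : ℝ, 0 < C ∧ ∀ k : ℕ, 2 ≤ k →
    ∑ p ∈ range (k + 1) with p.Prime, 1 / (p : ℝ) ≤ Real.log (Real.log k) + C := by
  have hl2 : 0 < Real.log 2 := Real.log_pos (by norm_num)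
  have hll2 : Real.log (Real.log 2) ≤ 0 :=
    Real.log_nonpos hl2.le (by linarith [Real.log_two_lt_d9])
  have h62 : 0 < 6 / Real.log 2 := by positivity
  refine ⟨1 + (6 / Real.log 2 - Real.log (Real.log 2)), by linarith, fun k hk => ?_⟩
  have hlog : 0 < Real.log k := Real.log_pos (by exact_mod_cast hk)
  have h1 := sum_vonMangoldt_div_mul_log_le hk
  have h2 : mangoldtSum k / Real.log k ≤ 1 + 6 / Real.log k := by
    rw [← div_self hlog.ne', ← add_div]
    exact div_le_div_of_nonneg_right (mangoldtSum_le (by omega)) hlog.le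
  have h3 : ∑ p ∈ range (k + 1) with p.Prime, 1 / (p : ℝ) ≤
      ∑ q ∈ Ioc 1 k, ArithmeticFunction.vonMangoldt q / ((q : ℝ) * Real.log q) := by
    calc ∑ p ∈ range (k + 1) with p.Prime, 1 / (p : ℝ)
        = ∑ p ∈ range (k + 1) with p.Prime,
          ArithmeticFunction.vonMangoldt p / ((p : ℝ) * Real.log p) := by
          refine sum_congr rfl fun p hp => ?_
          have hp := (mem_filter.1 hp).2
          have : 0 < Real.log p := Real.log_pos (by exact_mod_cast hp.one_lt)
          rw [ArithmeticFunction.vonMangoldt_apply_prime hp, div_mul_cancel_right₀ this.ne',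
            one_div]
      _ ≤ _ := by
          refine sum_le_sum_of_subset_of_nonneg (fun p hp => ?_) fun q _ _ =>
            div_nonneg ArithmeticFunction.vonMangoldt_nonneg
              (mul_nonneg (Nat.cast_nonneg _) (Real.log_natCast_nonneg q))
          obtain ⟨h, hp⟩ := mem_filter.1 hp
          exact mem_Ioc.2 ⟨hp.one_lt, Nat.lt_succ_iff.1 (mem_range.1 h)⟩
  linarith

theorem bigOmega_mul {m n : ℕ} (hm : m ≠ 0) (hn : n ≠ 0) :
    bigOmega (m * n) = bigOmega m + bigOmega n :=
  ArithmeticFunction.cardFactors_mul hm hn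

theorem bigOmega_prime_pow {p : ℕ} (hp : p.Prime) (k : ℕ) : bigOmega (p ^ k) = k :=
  ArithmeticFunction.cardFactors_apply_prime_pow hp

/-- The weight `z ^ Ω(m) ∏_{p ∣ m} (1 + 1/p)²`. -/
def omegaWeight (z : ℝ) (m : ℕ) : ℝ := z ^ bigOmega m * dedekindRatio m ^ 2

theorem omegaWeight_nonneg {z : ℝ} (hz : 0 ≤ z) (m : ℕ) : 0 ≤ omegaWeight z m :=
  mul_nonneg (pow_nonneg hz _) (sq_nonneg _)

theorem omegaWeight_one (z : ℝ) : omegaWeight z 1 = 1 := by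
  simp [omegaWeight, bigOmega, dedekindRatio]

theorem omegaWeight_mul_le {z : ℝ} (hz : 0 ≤ z) {m n : ℕ} (hm : m ≠ 0) (hn : n ≠ 0) :
    omegaWeight z (m * n) ≤ omegaWeight z m * omegaWeight z n := by
  have h1 := dedekindRatio_mul_le m n hm hn
  have h2 := one_le_dedekindRatio (m * n)
  calc omegaWeight z (m * n) = z ^ bigOmega (m * n) * dedekindRatio (m * n) ^ 2 := rfl
    _ ≤ z ^ bigOmega (m * n) * (dedekindRatio m * dedekindRatio n) ^ 2 := by gcongr
    _ = _ := by
      rw [bigOmega_mul hm hn, omegaWeight, omegaWeight]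
      ring

theorem omegaWeight_mul_of_coprime (z : ℝ) {m n : ℕ} (hm : m ≠ 0) (hn : n ≠ 0)
    (h : m.Coprime n) : omegaWeight z (m * n) = omegaWeight z m * omegaWeight z n := by
  have h1 : dedekindRatio (m * n) = dedekindRatio m * dedekindRatio n := by
    rw [dedekindRatio, Nat.primeFactors_mul hm hn, prod_union h.disjoint_primeFactors]
    rfl
  rw [omegaWeight, h1, bigOmega_mul hm hn, omegaWeight, omegaWeight]
  ring

theorem omegaWeight_prime_pow (z : ℝ) {p k : ℕ} (hp : p.Prime) (hk : k ≠ 0) :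
    omegaWeight z (p ^ k) = z ^ k * (1 + 1 / (p : ℝ)) ^ 2 := by
  rw [omegaWeight, bigOmega_prime_pow hp, dedekindRatio_prime_pow hp hk]

theorem omegaWeight_mul_vonMangoldt_le {z : ℝ} (hz : 0 ≤ z) (hz1 : z ≤ 1) (q : ℕ) :
    omegaWeight z q * ArithmeticFunction.vonMangoldt q ≤
      4 * ArithmeticFunction.vonMangoldt q := by
  by_cases hq : IsPrimePow q
  · obtain ⟨p, k, hp, hk, rfl⟩ := (isPrimePow_nat_iff q).1 hq
    refine mul_le_mul_of_nonneg_right ?_ ArithmeticFunction.vonMangoldt_nonneg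
    rw [omegaWeight_prime_pow z hp hk.ne']
    have h1 : 1 / (p : ℝ) ≤ 1 := by
      rw [div_le_one (by exact_mod_cast hp.pos)]
      exact_mod_cast hp.one_le
    have h0 : 0 ≤ 1 / (p : ℝ) := by positivity
    calc z ^ k * (1 + 1 / (p : ℝ)) ^ 2 ≤ 1 * 2 ^ 2 := by
          refine mul_le_mul (pow_le_one₀ hz hz1) ?_ (by positivity) zero_le_one
          exact pow_le_pow_left₀ (by linarith) (by linarith) 2
      _ = 4 := by norm_num
  · rw [ArithmeticFunction.vonMangoldt_eq_zero_iff.2 hq, mul_zero, mul_zero]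

theorem hasSum_omegaWeight_prime_pow {z : ℝ} (hz : 0 < z) (hz1 : z < 1) {p : ℕ} (hp : p.Prime) :
    HasSum (fun k : ℕ => omegaWeight z (p ^ k) / ((p ^ k : ℕ) : ℝ))
      (1 + (1 + 1 / (p : ℝ)) ^ 2 * (z / p / (1 - z / p))) := by
  have hp2 : (2 : ℝ) ≤ p := by exact_mod_cast hp.two_le
  have hp0 : (0 : ℝ) < p := by linarith
  have hr0 : 0 ≤ z / p := by positivity
  have hr1 : z / p < 1 := by
    rw [div_lt_one hp0]
    linarith
  rw [hasSum_nat_add_iff' 1 |>.symm]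
  have h := ((hasSum_geometric_of_lt_one hr0 hr1).mul_left (z / p)).mul_left
    ((1 + 1 / (p : ℝ)) ^ 2)
  convert! h using 1
  · ext k
    rw [omegaWeight_prime_pow z hp (Nat.succ_ne_zero k)]
    push_cast
    rw [div_pow, pow_succ, pow_succ]
    field_simp
    ring
  · rw [sum_range_one, pow_zero, omegaWeight_one, Nat.cast_one, div_one, ← div_eq_mul_inv]
    ring

theorem omegaWeight_local_factor_le {z : ℝ} (hz : 0 < z) (hz1 : z < 1) {p : ℕ} (hp : p.Prime) :
    1 + (1 + 1 / (p : ℝ)) ^ 2 * (z / p / (1 - z / p)) ≤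
      Real.exp (z * (1 / p) + 8 * (1 / (p : ℝ) ^ 2)) := by
  have hp2 : (2 : ℝ) ≤ p := by exact_mod_cast hp.two_le
  have hp0 : (0 : ℝ) < p := by linarith
  refine le_trans ?_ (Real.add_one_le_exp _)
  set u : ℝ := 1 / p with hu
  have hu0 : 0 < u := by positivity
  have hu2 : u ≤ 1 / 2 := one_div_le_one_div_of_le (by norm_num) hp2
  have e1 : z / p = z * u := by rw [hu]; ring
  have e2 : 1 / (p : ℝ) ^ 2 = u ^ 2 := by rw [hu]; ring
  rw [e1, e2]
  have hzu : z * u ≤ 1 / 2 := by nlinarith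
  have hzu0 : 0 < z * u := by positivity
  have h1 : z * u / (1 - z * u) ≤ z * u + 2 * u ^ 2 := by
    rw [div_le_iff₀ (by linarith)]
    nlinarith [mul_pos hu0 hu0, mul_pos hzu0 hu0, mul_nonneg hu0.le (sub_nonneg.2 hz1.le),
      mul_nonneg (sq_nonneg u) (sub_nonneg.2 hzu), mul_le_mul hz1.le hz1.le hz.le zero_le_one,
      mul_nonneg (sq_nonneg u) (mul_nonneg hz.le (sub_nonneg.2 hz1.le)), sq_nonneg u]
  have h2 : (1 + u) ^ 2 ≤ 1 + 3 * u := by nlinarith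
  have h3 : (1 + u) ^ 2 * (z * u / (1 - z * u)) ≤ (1 + 3 * u) * (z * u + 2 * u ^ 2) :=
    mul_le_mul h2 h1 (div_nonneg hzu0.le (by linarith)) (by positivity)
  have h4 : z * u * u ≤ u * u := by nlinarith [mul_pos hu0 hu0]
  nlinarith [mul_pos hu0 hu0, mul_nonneg (mul_pos hu0 hu0).le (sub_nonneg.2 hu2)]

theorem exists_sum_omegaWeight_div_le {z : ℝ} (hz : 0 < z) (hz1 : z < 1) :
    ∃ C : ℝ, 0 < C ∧ ∀ B : ℕ, 2 ≤ B →
      ∑ m ∈ Icc 1 B, omegaWeight z m / (m : ℝ) ≤ C * Real.log B ^ z := by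
  obtain ⟨C, hC, hMertens⟩ := exists_sum_primes_inv_le
  refine ⟨Real.exp (z * C + 16), Real.exp_pos _, fun B hB => ?_⟩
  have hlog : 0 < Real.log B := Real.log_pos (by exact_mod_cast hB)
  let g : ℕ → ℝ := fun m => omegaWeight z m / (m : ℝ)
  have hg0 : ∀ m, 0 ≤ g m := fun m => div_nonneg (omegaWeight_nonneg hz.le m) (Nat.cast_nonneg m)
  have hg1 : g 1 = 1 := by simp [g, omegaWeight_one]
  have hgmul : ∀ {m n : ℕ}, m.Coprime n → g (m * n) = g m * g n := by
    intro m n h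
    rcases eq_or_ne m 0 with rfl | hm
    · simp [g]
    rcases eq_or_ne n 0 with rfl | hn
    · simp [g]
    simp only [g]
    rw [omegaWeight_mul_of_coprime z hm hn h, Nat.cast_mul, mul_div_mul_comm]
  obtain ⟨hs, hS⟩ := EulerProduct.summable_and_hasSum_smoothNumbers_prod_primesBelow_tsum hg1 hgmul
    (fun {p} hp => (hasSum_omegaWeight_prime_pow hz hz1 hp).summable.norm) (B + 1)
  have h1 : ∑ m ∈ Icc 1 B, g m ≤ ∏ p ∈ (B + 1).primesBelow, ∑' k : ℕ, g (p ^ k) := by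
    let T : Finset (Nat.smoothNumbers (B + 1)) := (Icc 1 B).attach.image fun m =>
      ⟨m.1, Nat.mem_smoothNumbers_of_lt (mem_Icc.1 m.2).1 (Nat.lt_succ_of_le (mem_Icc.1 m.2).2)⟩
    have : ∑ m ∈ Icc 1 B, g m = ∑ m ∈ T, g m := by
      rw [sum_image, ← sum_attach]
      intro x _ y _ h
      exact Subtype.ext (congrArg (fun w : Nat.smoothNumbers (B + 1) => (w : ℕ)) h)
    rw [this]
    exact sum_le_hasSum T (fun m _ => hg0 m) hS
  have h2 : ∏ p ∈ (B + 1).primesBelow, ∑' k : ℕ, g (p ^ k) ≤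
      Real.exp (∑ p ∈ (B + 1).primesBelow, (z * (1 / p) + 8 * (1 / (p : ℝ) ^ 2))) := by
    rw [Real.exp_sum]
    refine prod_le_prod (fun p _ => tsum_nonneg fun k => hg0 _) fun p hp => ?_
    have hp := Nat.prime_of_mem_primesBelow hp
    rw [(hasSum_omegaWeight_prime_pow hz hz1 hp).tsum_eq]
    exact omegaWeight_local_factor_le hz hz1 hp
  have h3 : ∑ p ∈ (B + 1).primesBelow, (1 / (p : ℝ) ^ 2) ≤ 2 := by
    refine (sum_le_sum_of_subset_of_nonneg (t := Icc 1 B) (fun p hp => ?_)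
      fun p _ _ => by positivity).trans ((sum_inv_sq_Icc_le B (by omega)).trans ?_)
    · have h := Nat.lt_of_mem_primesBelow hp
      exact mem_Icc.2 ⟨(Nat.prime_of_mem_primesBelow hp).one_le, by omega⟩
    · have : (0 : ℝ) ≤ 1 / B := by positivity
      linarith
  have h4 : ∑ p ∈ (B + 1).primesBelow, (z * (1 / p) + 8 * (1 / (p : ℝ) ^ 2)) ≤
      z * Real.log (Real.log B) + (z * C + 16) := by
    rw [sum_add_distrib, ← mul_sum, ← mul_sum]
    have := hMertens B hB
    have h5 : ∑ p ∈ (B + 1).primesBelow, 1 / (p : ℝ) ≤ Real.log (Real.log B) + C := by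
      refine le_trans (le_of_eq ?_) this
      rw [Nat.primesBelow]
    nlinarith
  calc ∑ m ∈ Icc 1 B, omegaWeight z m / (m : ℝ) ≤
        Real.exp (z * Real.log (Real.log B) + (z * C + 16)) :=
        h1.trans (h2.trans (Real.exp_le_exp.2 h4))
    _ = _ := by
        rw [Real.exp_add, Real.rpow_def_of_pos hlog, mul_comm (Real.log (Real.log B)), mul_comm]

theorem sum_omegaWeight_mul_log_div_le {z A B : ℝ} (hz : 0 < z) (hz1 : z < 1) (hA : 0 < A)
    (hAB : A ≤ B) :
    ∑ a ∈ Ioc ⌊A⌋₊ ⌊B⌋₊, omegaWeight z a * Real.log a / (a : ℝ) ≤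
      4 * (Real.log (B / A) + 8) * ∑ m ∈ Icc 1 ⌊B⌋₊, omegaWeight z m / (m : ℝ) := by
  have hB0 : 0 < B := hA.trans_le hAB
  let F : ℕ × ℕ → ℝ := fun x => omegaWeight z x.2 / (x.2 : ℝ) *
    (4 * (ArithmeticFunction.vonMangoldt x.1 / (x.1 : ℝ)))
  have hF : ∀ x, 0 ≤ F x := fun x => mul_nonneg
    (div_nonneg (omegaWeight_nonneg hz.le _) (Nat.cast_nonneg _)) (mul_nonneg (by norm_num)
      (div_nonneg ArithmeticFunction.vonMangoldt_nonneg (Nat.cast_nonneg _)))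
  have h1 : ∀ a ∈ Ioc ⌊A⌋₊ ⌊B⌋₊, omegaWeight z a * Real.log a / (a : ℝ) ≤
      ∑ x ∈ a.divisorsAntidiagonal, F x := by
    intro a ha
    rw [← ArithmeticFunction.vonMangoldt_sum, ← Nat.sum_divisorsAntidiagonal
      (fun i _ => ArithmeticFunction.vonMangoldt i), mul_sum, sum_div]
    refine sum_le_sum fun x hx => ?_
    obtain ⟨rfl, h0⟩ := Nat.mem_divisorsAntidiagonal.1 hx
    obtain ⟨h01, h02⟩ := mul_ne_zero_iff.1 h0
    have hΛ : 0 ≤ ArithmeticFunction.vonMangoldt x.1 := ArithmeticFunction.vonMangoldt_nonneg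
    calc omegaWeight z (x.1 * x.2) * ArithmeticFunction.vonMangoldt x.1 / ((x.1 * x.2 : ℕ) : ℝ)
        ≤ (omegaWeight z x.1 * omegaWeight z x.2) * ArithmeticFunction.vonMangoldt x.1 /
          ((x.1 * x.2 : ℕ) : ℝ) := by
          have := omegaWeight_mul_le hz.le h01 h02
          gcongr
      _ = omegaWeight z x.2 / (x.2 : ℝ) *
          ((omegaWeight z x.1 * ArithmeticFunction.vonMangoldt x.1) / (x.1 : ℝ)) := by
          push_cast
          field_simp
      _ ≤ omegaWeight z x.2 / (x.2 : ℝ) * ((4 * ArithmeticFunction.vonMangoldt x.1) / (x.1 : ℝ)) := by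
          have := omegaWeight_mul_vonMangoldt_le hz.le hz1.le x.1
          have := omegaWeight_nonneg hz.le x.2
          gcongr
      _ = F x := by
          simp only [F]
          ring
  have h2 : ∑ a ∈ Ioc ⌊A⌋₊ ⌊B⌋₊, ∑ x ∈ a.divisorsAntidiagonal, F x ≤
      ∑ m ∈ Icc 1 ⌊B⌋₊, ∑ q ∈ Ioc ⌊A / m⌋₊ ⌊B / m⌋₊, F (q, m) := by
    rw [sum_sigma', sum_sigma']
    refine sum_le_sum_of_mapsTo_injOn (fun x : (_ : ℕ) × ℕ × ℕ =>
      (⟨x.2.2, x.2.1⟩ : (_ : ℕ) × ℕ)) ?_ ?_ (fun _ _ => le_rfl) fun _ _ => hF _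
    · rintro ⟨a, q, m⟩ hx
      simp only [mem_sigma, mem_Ioc, Nat.mem_divisorsAntidiagonal, mem_Icc] at hx ⊢
      obtain ⟨⟨ha1, ha2⟩, rfl, h0⟩ := hx
      obtain ⟨hq, hm⟩ := mul_ne_zero_iff.1 h0
      have hm0 : (0 : ℝ) < m := by exact_mod_cast Nat.pos_of_ne_zero hm
      rw [Nat.floor_lt hA.le] at ha1
      refine ⟨⟨Nat.pos_of_ne_zero hm, (Nat.le_mul_of_pos_left m (Nat.pos_of_ne_zero hq)).trans ha2⟩,
        ?_, ?_⟩
      · rw [Nat.floor_lt (by positivity), div_lt_iff₀ hm0]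
        exact_mod_cast ha1
      · rw [Nat.le_floor_iff (by positivity), le_div_iff₀ hm0]
        exact_mod_cast (Nat.le_floor_iff hB0.le).1 ha2
    · rintro ⟨a, q, m⟩ hx ⟨a', q', m'⟩ hx' h
      simp only [coe_sigma, Set.mem_sigma_iff, mem_coe, Nat.mem_divisorsAntidiagonal] at hx hx'
      simp only [Sigma.mk.injEq, heq_eq_eq] at h
      obtain ⟨rfl, rfl⟩ := h
      obtain ⟨-, rfl, -⟩ := hx
      obtain ⟨-, rfl, -⟩ := hx'
      rfl
  refine (sum_le_sum h1).trans (h2.trans ?_)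
  rw [mul_sum]
  refine sum_le_sum fun m hm => ?_
  obtain ⟨hm1, hm2⟩ := mem_Icc.1 hm
  have hm0 : (0 : ℝ) < m := by exact_mod_cast hm1
  simp only [F]
  rw [← mul_sum, ← mul_sum, mul_comm]
  refine mul_le_mul_of_nonneg_right ?_ (div_nonneg (omegaWeight_nonneg hz.le _) hm0.le)
  have := sum_vonMangoldt_div_Ioc_le (x := A / m) (y := B / m) (by positivity) (by gcongr)
    ((one_le_div hm0).2 ((Nat.le_floor_iff hB0.le).1 hm2))
  rw [div_div_div_cancel_right₀ hm0.ne'] at this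
  linarith

theorem exists_sum_omegaWeight_div_Ioc_le {z : ℝ} (hz : 0 < z) (hz1 : z < 1) :
    ∃ C : ℝ, 0 < C ∧ ∀ A B : ℝ, 1 < A → A ≤ B → 2 ≤ B →
      ∑ a ∈ Ioc ⌊A⌋₊ ⌊B⌋₊, omegaWeight z a / (a : ℝ) ≤
        C * (Real.log (B / A) + 8) * Real.log B ^ z / Real.log A := by
  obtain ⟨C, hC, h⟩ := exists_sum_omegaWeight_div_le hz hz1
  refine ⟨4 * C, by positivity, fun A B hA hAB hB => ?_⟩
  have hlogA : 0 < Real.log A := Real.log_pos hA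
  have hBA : 0 ≤ Real.log (B / A) := Real.log_nonneg ((one_le_div (by linarith)).2 hAB)
  have hB2 : 2 ≤ ⌊B⌋₊ := Nat.le_floor (by exact_mod_cast hB)
  rw [le_div_iff₀ hlogA, sum_mul]
  calc ∑ a ∈ Ioc ⌊A⌋₊ ⌊B⌋₊, omegaWeight z a / (a : ℝ) * Real.log A ≤
        ∑ a ∈ Ioc ⌊A⌋₊ ⌊B⌋₊, omegaWeight z a * Real.log a / (a : ℝ) := by
        refine sum_le_sum fun a ha => ?_
        have h1 : A < a := (Nat.floor_lt (by linarith)).1 (mem_Ioc.1 ha).1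
        rw [div_mul_eq_mul_div]
        have := omegaWeight_nonneg hz.le a
        have := Real.log_le_log (by linarith) h1.le
        gcongr
    _ ≤ 4 * (Real.log (B / A) + 8) * ∑ m ∈ Icc 1 ⌊B⌋₊, omegaWeight z m / (m : ℝ) :=
        sum_omegaWeight_mul_log_div_le hz hz1 (by linarith) hAB
    _ ≤ 4 * (Real.log (B / A) + 8) * (C * Real.log B ^ z) := by
        refine mul_le_mul_of_nonneg_left ((h _ hB2).trans ?_) (by linarith)
        have h3 : (⌊B⌋₊ : ℝ) ≤ B := Nat.floor_le (by linarith)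
        have h4 : (2 : ℝ) ≤ ⌊B⌋₊ := by exact_mod_cast hB2
        have h5 : 0 ≤ Real.log (⌊B⌋₊ : ℝ) := Real.log_nonneg (by linarith)
        have h6 := Real.log_le_log (by linarith) h3
        gcongr
    _ = _ := by ring

theorem exists_dedekindRatio_le : ∃ C : ℝ, 0 < C ∧ ∀ N : ℕ, 8 ≤ N → ∀ n : ℕ, n ≠ 0 → n ≤ N →
    dedekindRatio n ≤ C * Real.log (Real.log N) := by
  obtain ⟨C, hC, hMertens⟩ := exists_sum_primes_inv_le
  refine ⟨Real.exp (C + 2), Real.exp_pos _, fun N hN n hn hnN => ?_⟩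
  have hlog : 2 < Real.log N := by
    have h8 : Real.log 8 ≤ Real.log N := Real.log_le_log (by norm_num) (by exact_mod_cast hN)
    rw [show (8 : ℝ) = 2 ^ 3 by norm_num, Real.log_pow] at h8
    have := Real.log_two_gt_d9
    push_cast at h8
    linarith
  set K := ⌊Real.log N⌋₊ with hK
  have hK2 : 2 ≤ K := Nat.le_floor (by exact_mod_cast hlog.le)
  have hKlog : (K : ℝ) ≤ Real.log N := Nat.floor_le (by linarith)
  have hlogK : 0 < Real.log K := Real.log_pos (by exact_mod_cast hK2)
  have h1 : ∏ p ∈ n.primeFactors with p ≤ K, (1 + 1 / (p : ℝ)) ≤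
      Real.exp C * Real.log (Real.log N) := by
    calc ∏ p ∈ n.primeFactors with p ≤ K, (1 + 1 / (p : ℝ))
        ≤ Real.exp (∑ p ∈ n.primeFactors with p ≤ K, 1 / (p : ℝ)) := by
          rw [Real.exp_sum]
          refine prod_le_prod (fun p _ => by positivity) fun p _ => ?_
          rw [add_comm]
          exact Real.add_one_le_exp _
      _ ≤ Real.exp (Real.log (Real.log K) + C) := by
          refine Real.exp_le_exp.2 (le_trans ?_ (hMertens K hK2))
          refine sum_le_sum_of_subset_of_nonneg (fun p hp => ?_) fun p _ _ => by positivity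
          obtain ⟨hp1, hp2⟩ := mem_filter.1 hp
          exact mem_filter.2 ⟨mem_range.2 (by omega), Nat.prime_of_mem_primeFactors hp1⟩
      _ = Real.exp C * Real.log K := by
          rw [Real.exp_add, Real.exp_log hlogK, mul_comm]
      _ ≤ _ := mul_le_mul_of_nonneg_left (Real.log_le_log (by positivity) hKlog)
          (Real.exp_pos C).le
  have hcard : (#n.primeFactors : ℝ) * Real.log 2 ≤ Real.log N := by
    rw [← Real.log_pow]
    refine Real.log_le_log (by positivity) ?_
    have h2 : 2 ^ #n.primeFactors ≤ ∏ p ∈ n.primeFactors, p := by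
      rw [← prod_const]
      exact prod_le_prod' fun p hp => (Nat.prime_of_mem_primeFactors hp).two_le
    have h3 := Nat.le_of_dvd (Nat.pos_of_ne_zero hn) (Nat.prod_primeFactors_dvd n)
    exact_mod_cast h2.trans (h3.trans hnN)
  have h2 : ∏ p ∈ n.primeFactors with ¬ p ≤ K, (1 + 1 / (p : ℝ)) ≤ Real.exp 2 := by
    calc ∏ p ∈ n.primeFactors with ¬ p ≤ K, (1 + 1 / (p : ℝ))
        ≤ Real.exp (∑ p ∈ n.primeFactors with ¬ p ≤ K, 1 / (p : ℝ)) := by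
          rw [Real.exp_sum]
          refine prod_le_prod (fun p _ => by positivity) fun p _ => ?_
          rw [add_comm]
          exact Real.add_one_le_exp _
      _ ≤ Real.exp (∑ p ∈ n.primeFactors, 1 / Real.log N) := by
          refine Real.exp_le_exp.2 ((sum_le_sum (g := fun _ => 1 / Real.log N) fun p hp => ?_).trans
            (sum_le_sum_of_subset_of_nonneg (filter_subset _ _) fun p _ _ => by positivity))
          have hpK := not_le.1 (mem_filter.1 hp).2
          exact one_div_le_one_div_of_le (by linarith) (Nat.lt_of_floor_lt hpK).le
      _ ≤ Real.exp 2 := by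
          refine Real.exp_le_exp.2 ?_
          rw [sum_const, nsmul_eq_mul, mul_one_div, div_le_iff₀ (by linarith)]
          have := Real.log_two_gt_d9
          have h0 : (0 : ℝ) ≤ #n.primeFactors := Nat.cast_nonneg _
          nlinarith
  calc dedekindRatio n = _ := (prod_filter_mul_prod_filter_not _ (· ≤ K) _).symm
    _ ≤ Real.exp C * Real.log (Real.log N) * Real.exp 2 :=
        mul_le_mul h1 h2 (prod_nonneg fun p _ => by positivity)
          (mul_nonneg (Real.exp_pos C).le (Real.log_nonneg (by linarith)))
    _ = _ := by
        rw [Real.exp_add]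
        ring

theorem eventually_log_rpow_le (r : ℝ) {ε : ℝ} (hε : 0 < ε) :
    ∀ᶠ N : ℕ in Filter.atTop, Real.log N ^ r ≤ (N : ℝ) ^ ε := by
  have h := (isLittleO_log_rpow_rpow_atTop r hε).bound (c := 1) one_pos
  filter_upwards [tendsto_natCast_atTop_atTop.eventually h] with N hN
  rw [one_mul, Real.norm_of_nonneg (Real.rpow_nonneg (Real.log_natCast_nonneg N) r),
    Real.norm_of_nonneg (by positivity)] at hN
  exact hN

theorem card_prime_pairs_le_of_large {N a n : ℕ} (hn : n ≠ 0) (hlog : 1 ≤ Real.log N)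
    (h1 : Real.log N ^ (2 : ℝ) ≤ (N : ℝ) ^ (1 / 10 : ℝ)) (h2 : 2 ≤ (N : ℝ) ^ (1 / 200 : ℝ))
    (h3 : (N : ℝ) ^ (1 / 3 : ℝ) ≤ a) (h4 : (a : ℝ) ≤ (N : ℝ) ^ (2 / 3 : ℝ)) :
    (#{b ∈ Icc 1 (N / a) | (a * b + 1).Prime ∧ a * b + 1 < n ∧ (n - (a * b + 1)).Prime} : ℝ) ≤
      360003 * N / a * dedekindRatio a ^ 2 * dedekindRatio n / Real.log N ^ 2 := by
  have hN1 : (1 : ℝ) < N := by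
    by_contra h
    have := Real.log_nonpos (Nat.cast_nonneg N) (not_lt.1 h)
    linarith
  have hN0 : (0 : ℝ) < N := by linarith
  set M : ℝ := (N : ℝ) ^ (1 / 100 : ℝ) with hM
  have hM2 : M = (N : ℝ) ^ (1 / 200 : ℝ) * (N : ℝ) ^ (1 / 200 : ℝ) := by
    rw [← Real.rpow_add hN0, hM]
    norm_num
  have hMpos : 0 < M := Real.rpow_pos_of_pos hN0 _
  set Y := ⌊M⌋₊ with hY
  have hYM : (Y : ℝ) ≤ M := Nat.floor_le hMpos.le
  have hY2 : 2 ≤ Y := by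
    refine Nat.le_floor ?_
    rw [hM2]
    push_cast
    nlinarith
  have hY2' : (2 : ℝ) ≤ Y := by exact_mod_cast hY2
  have hYge : (N : ℝ) ^ (1 / 200 : ℝ) ≤ Y := by
    have := Nat.lt_floor_add_one M
    rw [← hY] at this
    nlinarith
  have hYa : Y ≤ a := by
    have : (Y : ℝ) ≤ a := hYM.trans ((Real.rpow_le_rpow_of_exponent_le hN1.le (by norm_num)).trans h3)
    exact_mod_cast this
  have ha0 : (0 : ℝ) < a := (Real.rpow_pos_of_pos hN0 _).trans_le h3
  have hlogY : Real.log N / 200 ≤ Real.log Y := by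
    have := Real.log_le_log (Real.rpow_pos_of_pos hN0 _) hYge
    rw [Real.log_rpow hN0] at this
    linarith
  have hψa := one_le_dedekindRatio a
  have hψn := one_le_dedekindRatio n
  have hX : ((N / a : ℕ) : ℝ) ≤ N / a := Nat.cast_div_le
  have hmain : 9 * ((N / a : ℕ) : ℝ) * dedekindRatio a ^ 2 * dedekindRatio n / Real.log Y ^ 2 ≤
      9 * (N / a) * dedekindRatio a ^ 2 * dedekindRatio n / (Real.log N / 200) ^ 2 := by
    gcongr
  have herr : (Y : ℝ) ^ 12 + Y + 1 ≤
      3 * (N / a) * dedekindRatio a ^ 2 * dedekindRatio n / Real.log N ^ 2 := by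
    have e1 : (Y : ℝ) ^ 12 + Y + 1 ≤ 3 * Y ^ 12 := by
      have : (Y : ℝ) ≤ Y ^ 12 := le_self_pow₀ (by linarith) (by norm_num)
      linarith
    have e2 : (Y : ℝ) ^ 12 ≤ (N : ℝ) ^ (12 / 100 : ℝ) := by
      calc (Y : ℝ) ^ 12 ≤ M ^ 12 := by gcongr
        _ = _ := by
          rw [hM, ← Real.rpow_natCast, ← Real.rpow_mul hN0.le]
          norm_num
    have e3 : (N : ℝ) ^ (1 / 3 : ℝ) ≤ N / a := by
      rw [le_div_iff₀ ha0]
      calc (N : ℝ) ^ (1 / 3 : ℝ) * a ≤ (N : ℝ) ^ (1 / 3 : ℝ) * (N : ℝ) ^ (2 / 3 : ℝ) := by gcongr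
        _ = N := by
          rw [← Real.rpow_add hN0]
          norm_num
    have e4 : (N : ℝ) ^ (12 / 100 : ℝ) * Real.log N ^ 2 ≤ N / a := by
      calc (N : ℝ) ^ (12 / 100 : ℝ) * Real.log N ^ 2
          ≤ (N : ℝ) ^ (12 / 100 : ℝ) * (N : ℝ) ^ (1 / 10 : ℝ) := by
            have := h1
            rw [Real.rpow_two] at this
            gcongr
        _ = (N : ℝ) ^ (22 / 100 : ℝ) := by
            rw [← Real.rpow_add hN0]
            norm_num
        _ ≤ (N : ℝ) ^ (1 / 3 : ℝ) := Real.rpow_le_rpow_of_exponent_le hN1.le (by norm_num)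
        _ ≤ _ := e3
    rw [le_div_iff₀ (by positivity)]
    have e5 : 1 ≤ dedekindRatio a ^ 2 * dedekindRatio n :=
      one_le_mul_of_one_le_of_one_le (one_le_pow₀ hψa) hψn
    calc ((Y : ℝ) ^ 12 + Y + 1) * Real.log N ^ 2
        ≤ (3 * (N : ℝ) ^ (12 / 100 : ℝ)) * Real.log N ^ 2 := by
          refine mul_le_mul_of_nonneg_right ?_ (sq_nonneg _)
          linarith
      _ = 3 * ((N : ℝ) ^ (12 / 100 : ℝ) * Real.log N ^ 2) := by ring
      _ ≤ 3 * (N / a) := by linarith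
      _ ≤ 3 * (N / a) * (dedekindRatio a ^ 2 * dedekindRatio n) :=
          le_mul_of_one_le_right (by positivity) e5
      _ = _ := by ring
  have h := card_prime_pairs_le hYa hY2 hn (N / a)
  refine h.trans ((add_le_add hmain herr).trans (le_of_eq ?_))
  have : Real.log N ≠ 0 := by linarith
  field_simp
  norm_num

theorem one_le_pow_bigOmega_mul {c L : ℝ} (hc : 0 < c) (hc1 : c < 1) (hL : 0 < L) {a : ℕ}
    (ha : (bigOmega a : ℝ) ≤ c * Real.log L) :
    1 ≤ c ^ bigOmega a * L ^ (-(c * Real.log c)) := by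
  rw [← Real.exp_log hc, ← Real.exp_nat_mul, Real.exp_log hc, Real.rpow_def_of_pos hL,
    ← Real.exp_add]
  refine Real.one_le_exp ?_
  have := Real.log_neg hc hc1
  nlinarith

theorem exists_mul_of_inP {N p : ℕ} {ω α : ℝ} (hlog : 1 ≤ Real.log N)
    (hp : p.Prime) (hpN : p ≤ N) (hΩ : (bigOmega (p - 1) : ℝ) ≤ α * Real.log (Real.log N))
    (hP : inP N ω p) (hlarge : N * Real.log N ^ (-3 : ℝ) < ((p - 1 : ℕ) : ℝ)) :
    ∃ a b : ℕ, a * b + 1 = p ∧ Real.sqrt N * Real.log N ^ (-(ω + 3)) < a ∧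
      (a : ℝ) < Real.sqrt N * Real.log N ^ ω ∧
      (bigOmega a : ℝ) ≤ α / 2 * Real.log (Real.log N) := by
  obtain ⟨d, ⟨m, hdm⟩, hd1, hd2⟩ := hP
  have hp2 := hp.two_le
  have hL : 0 < Real.log N := by linarith
  have hN0 : (0 : ℝ) < N := by exact_mod_cast hp.pos.trans_le hpN
  have hs : 0 < Real.sqrt N := Real.sqrt_pos.2 hN0
  have hss : Real.sqrt N * Real.sqrt N = N := Real.mul_self_sqrt hN0.le
  have hdm0 : d * m ≠ 0 := by omega
  obtain ⟨hd0, hm0⟩ := mul_ne_zero_iff.1 hdm0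
  have hm0' : (0 : ℝ) < m := by exact_mod_cast Nat.pos_of_ne_zero hm0
  have hd0' : (0 : ℝ) < d := by exact_mod_cast Nat.pos_of_ne_zero hd0
  have hdmN : (d : ℝ) * m ≤ N := by
    have : d * m ≤ N := by omega
    exact_mod_cast this
  have hLω : 0 < Real.log N ^ ω := Real.rpow_pos_of_pos hL _
  have e1 : Real.log N ^ (-(ω + 3)) * Real.log N ^ ω = Real.log N ^ (-3 : ℝ) := by
    rw [← Real.rpow_add hL]
    ring_nf
  have e2 : Real.log N ^ (-ω) * Real.log N ^ ω = 1 := by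
    rw [← Real.rpow_add hL, neg_add_cancel, Real.rpow_zero]
  have hm1 : Real.sqrt N * Real.log N ^ (-(ω + 3)) < m := by
    rw [hdm] at hlarge
    push_cast at hlarge
    have h : Real.sqrt N * Real.log N ^ (-(ω + 3)) * (Real.sqrt N * Real.log N ^ ω) =
        N * Real.log N ^ (-3 : ℝ) := by
      linear_combination
        (Real.log N ^ (-(ω + 3)) * Real.log N ^ ω) * hss + (N : ℝ) * e1
    have h' : (d : ℝ) * m ≤ m * (Real.sqrt N * Real.log N ^ ω) := by
      rw [mul_comm]
      gcongr
    exact lt_of_mul_lt_mul_right (h.trans_lt (hlarge.trans_le h')) (by positivity)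
  have hm2 : (m : ℝ) < Real.sqrt N * Real.log N ^ ω := by
    have h : Real.sqrt N * Real.log N ^ (-ω) * (Real.sqrt N * Real.log N ^ ω) = N := by
      linear_combination (Real.log N ^ (-ω) * Real.log N ^ ω) * hss + (N : ℝ) * e2
    have h' : Real.sqrt N * Real.log N ^ (-ω) * m < d * m := by gcongr
    exact lt_of_mul_lt_mul_left ((h'.trans_le hdmN).trans_eq h.symm) (by positivity)
  have hd3 : Real.sqrt N * Real.log N ^ (-(ω + 3)) < d := by
    refine lt_of_le_of_lt ?_ hd1
    have := Real.rpow_le_rpow_of_exponent_le hlog (by linarith : -(ω + 3) ≤ -ω)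
    gcongr
  rw [hdm, bigOmega_mul hd0 hm0] at hΩ
  push_cast at hΩ
  rcases le_total (bigOmega d : ℝ) (α / 2 * Real.log (Real.log N)) with h | h
  · exact ⟨d, m, by omega, hd3, hd2, h⟩
  · exact ⟨m, d, by rw [mul_comm]; omega, hm1, hm2, by linarith⟩

theorem card_goldbach_pairs_le {N n : ℕ} {ω α : ℝ} (hlog : 1 ≤ Real.log N) :
    (#{q ∈ range (N + 1) ×ˢ range (N + 1) | q.1.Prime ∧ q.2.Prime ∧ q.1 + q.2 = n ∧
        (bigOmega (q.1 - 1) : ℝ) ≤ α * Real.log (Real.log N) ∧ inP N ω q.1} : ℝ) ≤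
      N * Real.log N ^ (-3 : ℝ) +
      ∑ a ∈ Ioc ⌊Real.sqrt N * Real.log N ^ (-(ω + 3))⌋₊ ⌊Real.sqrt N * Real.log N ^ ω⌋₊ with
        (bigOmega a : ℝ) ≤ α / 2 * Real.log (Real.log N),
        (#{b ∈ Icc 1 (N / a) | (a * b + 1).Prime ∧ a * b + 1 < n ∧
          (n - (a * b + 1)).Prime} : ℝ) := by
  set P : Finset (ℕ × ℕ) := {q ∈ range (N + 1) ×ˢ range (N + 1) | q.1.Prime ∧ q.2.Prime ∧
    q.1 + q.2 = n ∧ (bigOmega (q.1 - 1) : ℝ) ≤ α * Real.log (Real.log N) ∧ inP N ω q.1} with hP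
  set I : Finset ℕ := {a ∈ Ioc ⌊Real.sqrt N * Real.log N ^ (-(ω + 3))⌋₊
    ⌊Real.sqrt N * Real.log N ^ ω⌋₊ | (bigOmega a : ℝ) ≤ α / 2 * Real.log (Real.log N)} with hI
  let Z : ℕ → Finset ℕ := fun a => {b ∈ Icc 1 (N / a) | (a * b + 1).Prime ∧ a * b + 1 < n ∧
    (n - (a * b + 1)).Prime}
  have h1 : #P = #(P.image fun q => q.1 - 1) := by
    rw [card_image_of_injOn]
    intro q hq q' hq' h
    obtain ⟨-, h1, h2, h3, -⟩ := mem_filter.1 (mem_coe.1 hq)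
    obtain ⟨-, h1', h2', h3', -⟩ := mem_filter.1 (mem_coe.1 hq')
    have := h1.two_le
    have := h1'.two_le
    simp only at h
    exact Prod.ext (by omega) (by omega)
  have h2 : P.image (fun q => q.1 - 1) ⊆ Icc 1 ⌊N * Real.log N ^ (-3 : ℝ)⌋₊ ∪
      I.biUnion fun a => (Z a).image fun b => a * b := by
    intro k hk
    obtain ⟨q, hq, rfl⟩ := mem_image.1 hk
    obtain ⟨hqN, hq1, hq2, hqn, hqΩ, hqP⟩ := mem_filter.1 hq
    have hq1N : q.1 ≤ N := Nat.lt_succ_iff.1 (mem_range.1 (mem_product.1 hqN).1)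
    have hq12 := hq1.two_le
    have hq22 := hq2.two_le
    rcases le_or_gt ((q.1 - 1 : ℕ) : ℝ) (N * Real.log N ^ (-3 : ℝ)) with h | h
    · exact mem_union_left _ (mem_Icc.2 ⟨by omega, Nat.le_floor h⟩)
    · obtain ⟨a, b, hab, ha1, ha2, ha3⟩ := exists_mul_of_inP hlog hq1 hq1N hqΩ hqP h
      refine mem_union_right _ (mem_biUnion.2 ⟨a, mem_filter.2 ⟨mem_Ioc.2 ⟨?_, Nat.le_floor ha2.le⟩,
        ha3⟩, mem_image.2 ⟨b, mem_filter.2 ⟨mem_Icc.2 ⟨?_, ?_⟩, ?_, ?_, ?_⟩, ?_⟩⟩)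
      · exact (Nat.floor_lt (mul_nonneg (Real.sqrt_nonneg _)
          (Real.rpow_nonneg (by linarith) _))).2 ha1
      · refine Nat.one_le_iff_ne_zero.2 ?_
        rintro rfl
        omega
      · have ha0 : 0 < a := Nat.pos_of_ne_zero (by rintro rfl; omega)
        rw [Nat.le_div_iff_mul_le ha0, mul_comm]
        omega
      · rwa [hab]
      · omega
      · have : n - (a * b + 1) = q.2 := by omega
        rwa [this]
      · omega
  have h3 : #P ≤ ⌊N * Real.log N ^ (-3 : ℝ)⌋₊ + ∑ a ∈ I, #(Z a) := by
    rw [h1]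
    refine (card_le_card h2).trans ((card_union_le _ _).trans (add_le_add ?_ ?_))
    · rw [Nat.card_Icc, Nat.add_sub_cancel]
    · exact card_biUnion_le.trans (sum_le_sum fun a _ => card_image_le)
  have h4 : (#P : ℝ) ≤ ⌊N * Real.log N ^ (-3 : ℝ)⌋₊ + ∑ a ∈ I, (#(Z a) : ℝ) := by
    exact_mod_cast h3
  refine h4.trans (add_le_add (Nat.floor_le ?_) le_rfl)
  exact mul_nonneg (Nat.cast_nonneg _) (Real.rpow_nonneg (by linarith) _)

/-- the number of ordered pairs of primes (p₁, p₂) with p₁ + p₂ = n,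
Ω(p₁ - 1) ≤ α log L and p₁ ∈ 𝒫 is ≪ N L^{γ(α/2) - 3} (log L)³, uniformly in 1 ≤ n ≤ N. -/
theorem goldbach_pairs_few_prime_factors :
    ∀ ω α : ℝ, 0 < ω → 1 < α → α < 3 / 2 → ∃ C : ℝ, 0 < C ∧ ∃ N0 : ℕ,
      ∀ N : ℕ, N0 ≤ N → ∀ n : ℕ, 1 ≤ n → n ≤ N →
        (((Finset.range (N + 1) ×ˢ Finset.range (N + 1)).filter
            (fun q => q.1.Prime ∧ q.2.Prime ∧ q.1 + q.2 = n ∧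
              (bigOmega (q.1 - 1) : ℝ) ≤ α * Real.log (Real.log N) ∧ inP N ω q.1)).card : ℝ) ≤
          C * (N : ℝ) * Real.log N ^ (gam (α / 2) - 3) * Real.log (Real.log N) ^ 3 := by
  intro ω α hω hα hα'
  set c := α / 2 with hc
  have hc0 : 0 < c := by linarith
  have hc1 : c < 1 := by linarith
  have hlogc : Real.log c < 0 := Real.log_neg hc0 hc1
  obtain ⟨C₂, hC₂, hψ⟩ := exists_dedekindRatio_le
  obtain ⟨C₃, hC₃, hmean⟩ := exists_sum_omegaWeight_div_Ioc_le hc0 hc1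
  refine ⟨1 + 360003 * C₂ * C₃ * (2 * ω + 11) * 3, by positivity, ?_⟩
  have hev1 : ∀ᶠ N : ℕ in Filter.atTop, Real.exp (Real.exp 1) ≤ N :=
    tendsto_natCast_atTop_atTop.eventually_ge_atTop _
  have hev2 : ∀ᶠ N : ℕ in Filter.atTop, 2 ≤ (N : ℝ) ^ (1 / 200 : ℝ) :=
    ((tendsto_rpow_atTop (by norm_num : (0 : ℝ) < 1 / 200)).comp
      tendsto_natCast_atTop_atTop).eventually_ge_atTop _
  obtain ⟨N0, hN0⟩ := Filter.eventually_atTop.1 (hev1.and (hev2.and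
    ((eventually_log_rpow_le 2 (by norm_num : (0 : ℝ) < 1 / 10)).and
      ((eventually_log_rpow_le (ω + 3) (by norm_num : (0 : ℝ) < 1 / 6)).and
        (Filter.eventually_ge_atTop 8)))))
  refine ⟨N0, fun N hN n hn hnN => ?_⟩
  obtain ⟨hNe, hN200, hN10, hN6, hN8⟩ := hN0 N hN
  have hNpos : (0 : ℝ) < N := (Real.exp_pos _).trans_le hNe
  have hN1 : (1 : ℝ) ≤ N := by
    have : (8 : ℝ) ≤ N := by exact_mod_cast hN8
    linarith
  have hLe : Real.exp 1 ≤ Real.log N := (Real.le_log_iff_exp_le hNpos).2 hNe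
  set L := Real.log N with hL
  have hL1 : 1 ≤ L := by linarith [Real.add_one_le_exp (1 : ℝ)]
  have hL0 : 0 < L := by linarith
  have hl1 : 1 ≤ Real.log L := (Real.le_log_iff_exp_le hL0).2 hLe
  set l := Real.log L with hl
  have hcard := card_goldbach_pairs_le (n := n) (ω := ω) (α := α) hL1
  rw [← hL, ← hl, ← hc] at hcard
  set s := Real.sqrt N with hs
  have hs' : s = (N : ℝ) ^ (1 / 2 : ℝ) := Real.sqrt_eq_rpow _
  set A := s * L ^ (-(ω + 3)) with hA
  set B := s * L ^ ω with hB
  have hspos : 0 < s := Real.sqrt_pos.2 hNpos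
  have hAge : (N : ℝ) ^ (1 / 3 : ℝ) ≤ A := by
    rw [hA, Real.rpow_neg hL0.le, ← div_eq_mul_inv, le_div_iff₀ (Real.rpow_pos_of_pos hL0 _), hs']
    calc (N : ℝ) ^ (1 / 3 : ℝ) * L ^ (ω + 3) ≤ (N : ℝ) ^ (1 / 3 : ℝ) * (N : ℝ) ^ (1 / 6 : ℝ) := by
          gcongr
      _ = _ := by
          rw [← Real.rpow_add hNpos]
          norm_num
  have hBle : B ≤ (N : ℝ) ^ (2 / 3 : ℝ) := by
    rw [hB, hs']
    calc (N : ℝ) ^ (1 / 2 : ℝ) * L ^ ω ≤ (N : ℝ) ^ (1 / 2 : ℝ) * (N : ℝ) ^ (1 / 6 : ℝ) := by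
          have := Real.rpow_le_rpow_of_exponent_le hL1 (by linarith : ω ≤ ω + 3)
          have := this.trans hN6
          gcongr
      _ = _ := by
          rw [← Real.rpow_add hNpos]
          norm_num
  have hN3 : 2 ≤ (N : ℝ) ^ (1 / 3 : ℝ) :=
    hN200.trans (Real.rpow_le_rpow_of_exponent_le hN1 (by norm_num))
  have hA2 : 2 ≤ A := hN3.trans hAge
  have hAB : A ≤ B := by
    have := Real.rpow_le_rpow_of_exponent_le hL1 (by linarith : -(ω + 3) ≤ ω)
    rw [hA, hB]
    gcongr
  have hlogBA : Real.log (B / A) = (2 * ω + 3) * l := by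
    rw [hA, hB, mul_div_mul_left _ _ hspos.ne', ← Real.rpow_sub hL0, Real.log_rpow hL0]
    ring
  have hlogA : L / 3 ≤ Real.log A := by
    have := Real.log_le_log (by linarith) hAge
    rw [Real.log_rpow hNpos] at this
    linarith
  have hlogB : Real.log B ≤ L := by
    have := Real.log_le_log (by linarith) hBle
    rw [Real.log_rpow hNpos] at this
    linarith
  have hψn := hψ N hN8 n (by omega) hnN
  have hψn1 := one_le_dedekindRatio n
  set R := L ^ (-(c * Real.log c)) with hR
  have hR0 : 0 < R := Real.rpow_pos_of_pos hL0 _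
  have hZ : ∀ a ∈ Ioc ⌊A⌋₊ ⌊B⌋₊, (bigOmega a : ℝ) ≤ c * l →
      (#{b ∈ Icc 1 (N / a) | (a * b + 1).Prime ∧ a * b + 1 < n ∧ (n - (a * b + 1)).Prime} : ℝ) ≤
        360003 * N * dedekindRatio n / L ^ 2 * R * (omegaWeight c a / a) := by
    intro a ha hΩ
    obtain ⟨ha1, ha2⟩ := mem_Ioc.1 ha
    have ha1' : A < a := (Nat.floor_lt (by linarith)).1 ha1
    have ha2' : (a : ℝ) ≤ B := (Nat.le_floor_iff (by linarith)).1 ha2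
    have h1 := card_prime_pairs_le_of_large (by omega : n ≠ 0) hL1 hN10 hN200
      (hAge.trans ha1'.le) (ha2'.trans hBle)
    refine h1.trans ?_
    have h2 := one_le_pow_bigOmega_mul hc0 hc1 hL0 hΩ
    rw [← hR] at h2
    have ha0 : (0 : ℝ) < a := by linarith
    calc 360003 * N / a * dedekindRatio a ^ 2 * dedekindRatio n / L ^ 2
        ≤ 360003 * N / a * dedekindRatio a ^ 2 * dedekindRatio n / L ^ 2 *
          (c ^ bigOmega a * R) := le_mul_of_one_le_right (by positivity) h2
      _ = _ := by
        rw [omegaWeight]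
        ring
  have hsum : ∑ a ∈ Ioc ⌊A⌋₊ ⌊B⌋₊ with (bigOmega a : ℝ) ≤ c * l,
      (#{b ∈ Icc 1 (N / a) | (a * b + 1).Prime ∧ a * b + 1 < n ∧ (n - (a * b + 1)).Prime} : ℝ) ≤
      360003 * N * dedekindRatio n / L ^ 2 * R *
        ∑ a ∈ Ioc ⌊A⌋₊ ⌊B⌋₊, omegaWeight c a / (a : ℝ) := by
    rw [mul_sum]
    refine (sum_le_sum fun a ha => hZ a (mem_filter.1 ha).1 (mem_filter.1 ha).2).trans ?_
    refine sum_le_sum_of_subset_of_nonneg (filter_subset _ _) fun a _ _ => ?_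
    have := omegaWeight_nonneg hc0.le a
    positivity
  have hmeanAB : ∑ a ∈ Ioc ⌊A⌋₊ ⌊B⌋₊, omegaWeight c a / (a : ℝ) ≤
      C₃ * ((2 * ω + 11) * l) * L ^ c / (L / 3) := by
    refine (hmean A B (by linarith) hAB (by linarith)).trans ?_
    have h1 : Real.log (B / A) + 8 ≤ (2 * ω + 11) * l := by
      rw [hlogBA]
      linarith
    have h0 : 0 ≤ Real.log B := Real.log_nonneg (by linarith)
    gcongr
  have hpow : L ^ (gam c - 3) = R * L ^ c / (L ^ 2 * L) := by
    rw [hR, ← Real.rpow_add hL0, ← pow_succ, ← Real.rpow_natCast L (2 + 1), ← Real.rpow_sub hL0,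
      gam]
    congr 1
    push_cast
    ring
  have hgam : L ^ (-3 : ℝ) ≤ L ^ (gam c - 3) := by
    refine Real.rpow_le_rpow_of_exponent_le hL1 ?_
    rw [gam]
    nlinarith
  have hG : 0 < L ^ (gam c - 3) := Real.rpow_pos_of_pos hL0 _
  have hmain : 360003 * N * dedekindRatio n / L ^ 2 * R *
        ∑ a ∈ Ioc ⌊A⌋₊ ⌊B⌋₊, omegaWeight c a / (a : ℝ) ≤
      360003 * C₂ * C₃ * (2 * ω + 11) * 3 * N * L ^ (gam c - 3) * l ^ 2 := by
    have hsum0 : 0 ≤ ∑ a ∈ Ioc ⌊A⌋₊ ⌊B⌋₊, omegaWeight c a / (a : ℝ) :=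
      sum_nonneg fun a _ => div_nonneg (omegaWeight_nonneg hc0.le a) a.cast_nonneg
    have hl0 : 0 < l := by linarith
    calc _ ≤ 360003 * N * (C₂ * l) / L ^ 2 * R * (C₃ * ((2 * ω + 11) * l) * L ^ c / (L / 3)) :=
          mul_le_mul (by gcongr) hmeanAB hsum0 (by positivity)
      _ = _ := by
          rw [hpow]
          field_simp
  have hl23 : l ^ 2 ≤ l ^ 3 := pow_le_pow_right₀ hl1 (by norm_num)
  have hl3 : 1 ≤ l ^ 3 := one_le_pow₀ hl1
  calc _ ≤ N * L ^ (-3 : ℝ) + 360003 * C₂ * C₃ * (2 * ω + 11) * 3 * N * L ^ (gam c - 3) * l ^ 2 :=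
        hcard.trans (add_le_add le_rfl (hsum.trans hmain))
    _ ≤ N * L ^ (gam c - 3) * l ^ 3 +
        360003 * C₂ * C₃ * (2 * ω + 11) * 3 * N * L ^ (gam c - 3) * l ^ 3 := by
        refine add_le_add ?_ (by gcongr)
        calc N * L ^ (-3 : ℝ) ≤ N * L ^ (gam c - 3) := by gcongr
          _ ≤ _ := le_mul_of_one_le_right (by positivity) hl3
    _ = _ := by ring
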